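/- arXiv:1703.04815 — 2 statements merged into one kernel-verified Lean document; each statement's English description precedes it below -/
import Mathlib

section
/- For every integer r ≥ 4 and every real ε > 0 there exists a constant Δ₀ such that for every graph G with maximum degree Δ ≥ Δ₀ and minimum degree δ ≥ (ln Δ)^8, the r-distant sum distinguishing index satisfies χ'_{Σ,r}(G) ≤ (4 + ε)·Δ^{r-1}. -/
open Finset

/-- A proper edge colouring of `G` with colours in `{1,…,k}` that sum-distinguishes every
pair of distinct vertices at distance at most `r`. -/
def DistSumDistinguishing {V : Type*} [Fintype V] [DecidableEq V]
    (G : SimpleGraph V) [DecidableRel G.Adj] (r k : ℕ) : Prop :=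
  ∃ c : Sym2 V → ℕ,
    (∀ e ∈ G.edgeSet, 1 ≤ c e ∧ c e ≤ k) ∧
    (∀ e₁ ∈ G.edgeSet, ∀ e₂ ∈ G.edgeSet, e₁ ≠ e₂ → (∃ v, v ∈ e₁ ∧ v ∈ e₂) → c e₁ ≠ c e₂) ∧
    (∀ u v : V, 0 < G.dist u v → G.dist u v ≤ r →
      ∑ w ∈ G.neighborFinset u, c s(u, w) ≠ ∑ w ∈ G.neighborFinset v, c s(v, w))

/-- The `r`-distant sum distinguishing index `χ'_{Σ,r}(G)`. -/
noncomputable def distSumDistIndex {V : Type*} [Fintype V] [DecidableEq V]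
    (G : SimpleGraph V) [DecidableRel G.Adj] (r : ℕ) : ℕ :=
  sInf {k | DistSumDistinguishing G r k}

section LocalLemma

variable {ι V α : Type*} [Fintype V] [DecidableEq V] [Fintype α] [DecidableEq α]

/-- Events determined by disjoint sets of coordinates are independent for the uniform
distribution on `V → α`. -/
theorem card_inter_mul_card_of_disjoint_support (A B : Finset (V → α)) (S T : Finset V)
    (hST : Disjoint S T)
    (hA : ∀ f g : V → α, (∀ u ∈ S, f u = g u) → f ∈ A → g ∈ A)
    (hB : ∀ f g : V → α, (∀ u ∈ T, f u = g u) → f ∈ B → g ∈ B) :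
    #(A ∩ B) * Fintype.card (V → α) = #A * #B := by
  rw [← Finset.card_univ, ← Finset.card_product, ← Finset.card_product]
  let swap : (V → α) × (V → α) → (V → α) × (V → α) := fun q =>
    (fun u => if u ∈ S then q.1 u else q.2 u, fun u => if u ∈ S then q.2 u else q.1 u)
  have hinv : ∀ q, swap (swap q) = q := by
    rintro ⟨f, g⟩
    refine Prod.ext (funext fun u => ?_) (funext fun u => ?_) <;>
      by_cases hu : u ∈ S <;> simp [swap, hu]
  refine Finset.card_bij' (fun q _ => swap q) (fun q _ => swap q) ?_ ?_
    (fun q _ => hinv q) (fun q _ => hinv q)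
  · rintro ⟨f, g⟩ h
    simp only [mem_product, mem_inter, mem_univ, and_true] at h ⊢
    refine ⟨hA f _ (fun u hu => by simp [swap, hu]) h.1, hB f _ (fun u hu => ?_) h.2⟩
    have : u ∉ S := fun h' => Finset.disjoint_left.mp hST h' hu
    simp [swap, this]
  · rintro ⟨f, g⟩ h
    simp only [mem_product, mem_inter, mem_univ, and_true] at h ⊢
    refine ⟨hA f _ (fun u hu => by simp [swap, hu]) h.1, hB g _ (fun u hu => ?_) h.2⟩
    have : u ∉ S := fun h' => Finset.disjoint_left.mp hST h' hu
    simp [swap, this]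

/-- The symmetric Lovász local lemma for the uniform distribution on `V → α`. -/
theorem exists_forall_notMem_of_local [Fintype ι] [DecidableEq ι] [Nonempty α]
    (bad : ι → Finset (V → α)) (T : ι → Finset V)
    (hdep : ∀ i f g, (∀ u ∈ T i, f u = g u) → f ∈ bad i → g ∈ bad i)
    (p D : ℝ) (hp0 : 0 ≤ p) (hp : ∀ i, (#(bad i) : ℝ) ≤ p * Fintype.card (V → α))
    (hD1 : 1 ≤ D) (hD : ∀ i, (#{j | ¬ Disjoint (T i) (T j)} : ℝ) ≤ D) (hpD : 4 * p * D ≤ 1) :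
    ∃ f : V → α, ∀ i, f ∉ bad i := by
  let good : Finset ι → Finset (V → α) := fun S => univ.filter fun f => ∀ i ∈ S, f ∉ bad i
  have hΩ : (0 : ℝ) < Fintype.card (V → α) := by exact_mod_cast Fintype.card_pos
  have hmono : ∀ S S', S ⊆ S' → good S' ⊆ good S := fun S S' h f hf => by
    simp only [good, mem_filter, mem_univ, true_and] at hf ⊢
    exact fun i hi => hf i (h hi)
  have key : ∀ S : Finset ι, ∀ i, (#(bad i ∩ good S) : ℝ) ≤ 2 * p * #(good S) := by
    intro S
    induction S using Finset.strongInduction with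
    | H S ih =>
      intro i
      let S1 := S.filter fun j => ¬ Disjoint (T i) (T j)
      let S2 := S.filter fun j => Disjoint (T i) (T j)
      have hind : (#(bad i ∩ good S2) : ℝ) ≤ p * #(good S2) := by
        have h := card_inter_mul_card_of_disjoint_support (bad i) (good S2) (T i)
          (S2.biUnion T) (by
            rw [Finset.disjoint_biUnion_right]
            exact fun j hj => (mem_filter.mp hj).2) (hdep i) (by
            intro f g hfg hf
            simp only [good, mem_filter, mem_univ, true_and] at hf ⊢
            intro j hj hg
            exact hf j hj (hdep j g f (fun u hu =>
              (hfg u (mem_biUnion.mpr ⟨j, hj, hu⟩)).symm) hg))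
        have h' : (#(bad i ∩ good S2) : ℝ) * Fintype.card (V → α) = #(bad i) * #(good S2) := by
          exact_mod_cast h
        have h2 := mul_le_mul_of_nonneg_right (hp i) (Nat.cast_nonneg (α := ℝ) #(good S2))
        rw [← h'] at h2
        refine le_of_mul_le_mul_right (h2.trans_eq ?_) hΩ
        ring
      have hle : (#(bad i ∩ good S) : ℝ) ≤ #(bad i ∩ good S2) := by
        exact_mod_cast Finset.card_le_card
          (Finset.inter_subset_inter_left (hmono _ _ (Finset.filter_subset _ _)))
      have hhalf : (#(good S2) : ℝ) ≤ 2 * #(good S) := by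
        by_cases hS1 : S1 = ∅
        · have : S2 = S := by
            refine Finset.filter_true_of_mem fun j hj => ?_
            by_contra hn
            exact Finset.notMem_empty j (hS1 ▸ mem_filter.mpr ⟨hj, hn⟩)
          rw [this]
          have : (0 : ℝ) ≤ #(good S) := Nat.cast_nonneg _
          linarith
        · obtain ⟨j0, hj0⟩ := Finset.nonempty_iff_ne_empty.mpr hS1
          have hss : S2 ⊂ S := by
            refine Finset.filter_ssubset.mpr ⟨j0, (mem_filter.mp hj0).1, (mem_filter.mp hj0).2⟩
          have hcov : good S2 ⊆ good S ∪ S1.biUnion fun j => bad j ∩ good S2 := by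
            intro f hf
            by_cases hfS : f ∈ good S
            · exact mem_union_left _ hfS
            · refine mem_union_right _ ?_
              simp only [good, mem_filter, mem_univ, true_and, not_forall, not_not] at hfS
              obtain ⟨j, hj, hfj⟩ := hfS
              refine mem_biUnion.mpr ⟨j, ?_, mem_inter.mpr ⟨hfj, hf⟩⟩
              refine mem_filter.mpr ⟨hj, fun hdis => ?_⟩
              exact (mem_filter.mp hf).2 j (mem_filter.mpr ⟨hj, hdis⟩) hfj
          have h1 : (#(good S2) : ℝ) ≤ #(good S) + ∑ j ∈ S1, (#(bad j ∩ good S2) : ℝ) := by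
            have := (Finset.card_le_card hcov).trans (Finset.card_union_le _ _)
            have := this.trans (Nat.add_le_add_left Finset.card_biUnion_le _)
            exact_mod_cast this
          have h2 : ∑ j ∈ S1, (#(bad j ∩ good S2) : ℝ) ≤ #S1 * (2 * p * #(good S2)) := by
            rw [← nsmul_eq_mul]
            exact Finset.sum_le_card_nsmul _ _ _ fun j _ => ih S2 hss j
          have h3 : (#S1 : ℝ) ≤ D := by
            refine le_trans ?_ (hD i)
            exact_mod_cast Finset.card_le_card (Finset.filter_subset_filter _ (subset_univ _))
          have h4 : (#S1 : ℝ) * (2 * p * #(good S2)) ≤ D * (2 * p * #(good S2)) := by gcongr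
          have h5 : D * (2 * p * #(good S2)) ≤ 1 / 2 * #(good S2) := by
            have : (0 : ℝ) ≤ #(good S2) := Nat.cast_nonneg _
            nlinarith
          linarith
      have := mul_le_mul_of_nonneg_left hhalf hp0
      linarith
  have hpos : ∀ S : Finset ι, 0 < #(good S) := by
    intro S
    induction S using Finset.induction_on with
    | empty => simpa [good] using pow_pos (Fintype.card_pos (α := α)) (Fintype.card V)
    | insert i S _ ih =>
      have hcov : good S ⊆ good (insert i S) ∪ (bad i ∩ good S) := by
        intro f hf
        by_cases hfi : f ∈ bad i
        · exact mem_union_right _ (mem_inter.mpr ⟨hfi, hf⟩)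
        · refine mem_union_left _ (mem_filter.mpr ⟨mem_univ _, fun j hj => ?_⟩)
          rcases Finset.mem_insert.mp hj with rfl | hj
          · exact hfi
          · exact (mem_filter.mp hf).2 j hj
      have h1 : (#(good S) : ℝ) ≤ #(good (insert i S)) + #(bad i ∩ good S) := by
        exact_mod_cast (Finset.card_le_card hcov).trans (Finset.card_union_le _ _)
      have h2 := key S i
      have h3 : (0 : ℝ) < #(good S) := by exact_mod_cast ih
      have h4 : 2 * p ≤ 1 / 2 := by nlinarith
      have h5 : (0 : ℝ) < #(good (insert i S)) := by nlinarith
      exact_mod_cast h5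
  obtain ⟨f, hf⟩ := Finset.card_pos.mp (hpos univ)
  exact ⟨f, fun i => (mem_filter.mp hf).2 i (mem_univ _)⟩

end LocalLemma

section Chernoff

variable {V : Type*} [Fintype V] [DecidableEq V] {M : ℕ}

theorem sum_pow_card_filter_eq (hM : 0 < M) (S : Finset V) (i : Fin M) (y : ℝ) :
    ∑ f : V → Fin M, y ^ #{u ∈ S | f u = i} =
      Fintype.card (V → Fin M) * (1 + (y - 1) / M) ^ #S := by
  have hM' : (M : ℝ) ≠ 0 := by positivity
  have h1 : ∀ f : V → Fin M, y ^ #{u ∈ S | f u = i} =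
      ∏ u, if u ∈ S then (if f u = i then y else 1) else 1 := by
    intro f
    rw [← Finset.prod_const, Finset.prod_filter, Finset.prod_ite_mem, Finset.univ_inter]
  have h2 := Finset.prod_univ_sum (fun _ : V => (univ : Finset (Fin M)))
    (fun u j => if u ∈ S then (if j = i then y else 1) else (1 : ℝ))
  rw [Fintype.piFinset_univ] at h2
  rw [Finset.sum_congr rfl fun f _ => h1 f, ← h2]
  have h3 : ∀ u : V, (∑ j : Fin M, if u ∈ S then (if j = i then y else 1) else (1 : ℝ)) =
      M * (if u ∈ S then 1 + (y - 1) / M else 1) := by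
    intro u
    by_cases hu : u ∈ S
    · have : ∀ j : Fin M, (if j = i then y else (1 : ℝ)) = 1 + if j = i then y - 1 else 0 := by
        intro j; split_ifs <;> ring
      simp only [hu, if_true, this, Finset.sum_add_distrib]
      simp
      field_simp
    · simp [hu]
  rw [Finset.prod_congr rfl fun u _ => h3 u, Finset.prod_mul_distrib, Finset.prod_ite_mem,
    Finset.univ_inter]
  simp

/-- Chernoff's bound for the size of a colour class within `S`, in either tail:
`y < 1` controls the lower tail, `y > 1` the upper one. -/
theorem card_filter_rpow_le (hM : 0 < M) (S : Finset V) (i : Fin M) {y m : ℝ} (hy : 0 < y)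
    (hm : (y - 1) * #S ≤ (y - 1) * m) :
    (#{f : V → Fin M | y ^ (y * m / M) ≤ y ^ (#{u ∈ S | f u = i} : ℝ)} : ℝ) ≤
      Real.exp (-((1 - y + y * Real.log y) / M * m)) * Fintype.card (V → Fin M) := by
  have hM' : (0 : ℝ) < M := by exact_mod_cast hM
  have hM1 : (1 : ℝ) ≤ M := by exact_mod_cast hM
  set z : ℝ := y ^ (y * m / M) with hz
  have hz0 : 0 < z := Real.rpow_pos_of_pos hy _
  have h1 : (#{f : V → Fin M | z ≤ y ^ (#{u ∈ S | f u = i} : ℝ)} : ℝ) * z ≤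
      ∑ f : V → Fin M, y ^ #{u ∈ S | f u = i} := by
    rw [← nsmul_eq_mul]
    refine (Finset.card_nsmul_le_sum _ (fun f : V → Fin M => y ^ #{u ∈ S | f u = i}) z
      fun f hf => ?_).trans
      (Finset.sum_le_sum_of_subset_of_nonneg (Finset.filter_subset _ _) fun _ _ _ => by positivity)
    simpa using (mem_filter.mp hf).2
  rw [sum_pow_card_filter_eq hM] at h1
  have h2 : (1 + (y - 1) / M) ^ #S ≤ Real.exp ((y - 1) * m / M) := by
    have h0 : 0 ≤ 1 + (y - 1) / M := by
      have : -1 ≤ (y - 1) / M := by rw [le_div_iff₀ hM']; linarith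
      linarith
    calc (1 + (y - 1) / M) ^ #S ≤ Real.exp ((y - 1) / M) ^ #S := by
          gcongr
          linarith [Real.add_one_le_exp ((y - 1) / M)]
      _ = Real.exp ((y - 1) * #S / M) := by
          rw [← Real.exp_nat_mul]; congr 1; ring
      _ ≤ _ := by gcongr
  have hzexp : z = Real.exp (Real.log y * (y * m / M)) := by
    rw [hz, Real.rpow_def_of_pos hy]
  have h3 : Real.exp (-((1 - y + y * Real.log y) / M * m)) * z = Real.exp ((y - 1) * m / M) := by
    rw [hzexp, ← Real.exp_add]
    congr 1
    field_simp
    ring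
  have h4 : (#{f : V → Fin M | z ≤ y ^ (#{u ∈ S | f u = i} : ℝ)} : ℝ) * z ≤
      Real.exp (-((1 - y + y * Real.log y) / M * m)) * Fintype.card (V → Fin M) * z := by
    calc _ ≤ _ := h1
      _ ≤ Fintype.card (V → Fin M) * Real.exp ((y - 1) * m / M) := by gcongr
      _ = _ := by rw [← h3]; ring
  exact le_of_mul_le_mul_right h4 hz0

theorem one_sub_add_mul_log_pos {y : ℝ} (hy : 0 < y) (hy1 : y ≠ 1) :
    0 < 1 - y + y * Real.log y := by
  have h := Real.log_lt_sub_one_of_pos (inv_pos.mpr hy) (by simpa using hy1)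
  rw [Real.log_inv] at h
  have h2 := mul_lt_mul_of_pos_left h hy
  rw [mul_sub, mul_inv_cancel₀ hy.ne'] at h2
  linarith

end Chernoff

section Balls

variable {V : Type*}

theorem exists_adj_dist_add_one_eq {G : SimpleGraph V} {u v : V} (h : 0 < G.dist v u) :
    ∃ w, G.Adj w u ∧ G.dist v w + 1 = G.dist v u := by
  obtain ⟨p, hp⟩ := (SimpleGraph.Reachable.of_dist_ne_zero h.ne').exists_walk_length_eq_dist
  have hnil : ¬ p.Nil := fun hn => by
    rw [SimpleGraph.Walk.length_eq_zero_iff.mpr hn] at hp; omega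
  have hadj := p.adj_penultimate hnil
  refine ⟨p.penultimate, hadj, le_antisymm ?_ ?_⟩
  · have h1 : G.dist v p.penultimate ≤ p.dropLast.length := SimpleGraph.dist_le _
    have h2 : p.dropLast.length + 1 = p.length := p.length_dropLast_add_one hnil
    omega
  · have := (hadj.reachable).dist_triangle_right v
    rwa [SimpleGraph.dist_eq_one_iff_adj.mpr hadj] at this

variable [Fintype V]

/-- The punctured ball of radius `r` around `v`. -/
noncomputable def distBall (G : SimpleGraph V) (r : ℕ) (v : V) : Finset V :=
  univ.filter fun u => 0 < G.dist v u ∧ G.dist v u ≤ r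

theorem mem_distBall {G : SimpleGraph V} {r : ℕ} {u v : V} :
    u ∈ distBall G r v ↔ 0 < G.dist v u ∧ G.dist v u ≤ r := by
  simp [distBall]

theorem mem_distBall_comm {G : SimpleGraph V} {r : ℕ} {u v : V} :
    u ∈ distBall G r v ↔ v ∈ distBall G r u := by
  rw [mem_distBall, mem_distBall, G.dist_comm]

theorem notMem_distBall_self {G : SimpleGraph V} {r : ℕ} {v : V} : v ∉ distBall G r v := by
  simp [mem_distBall]

theorem card_distBall_le [DecidableEq V] (G : SimpleGraph V) [DecidableRel G.Adj] (r : ℕ) (v : V) :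
    #(distBall G (r + 1) v) ≤ G.degree v * G.maxDegree ^ r := by
  induction r with
  | zero =>
    rw [pow_zero, mul_one, ← G.card_neighborFinset_eq_degree]
    refine Finset.card_le_card fun u hu => ?_
    rw [mem_distBall] at hu
    rw [SimpleGraph.mem_neighborFinset, ← SimpleGraph.dist_eq_one_iff_adj]
    omega
  | succ r ih =>
    have hpred : ∀ u, ∃ w, 0 < G.dist v u → G.Adj w u ∧ G.dist v w + 1 = G.dist v u := by
      intro u
      by_cases h : 0 < G.dist v u
      · obtain ⟨w, hw⟩ := exists_adj_dist_add_one_eq h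
        exact ⟨w, fun _ => hw⟩
      · exact ⟨u, fun h' => absurd h' h⟩
    choose pred hpred using hpred
    have hcov : distBall G (r + 1 + 1) v ⊆ (distBall G (r + 1) v).biUnion
        fun u => (insert u (G.neighborFinset u)).erase (pred u) := by
      intro x hx
      rw [mem_distBall] at hx
      obtain ⟨hadj, hdist⟩ := hpred x hx.1
      rw [mem_biUnion]
      by_cases hxr : G.dist v x ≤ r + 1
      · exact ⟨x, mem_distBall.mpr ⟨hx.1, hxr⟩, by simp [hadj.ne']⟩
      · refine ⟨pred x, mem_distBall.mpr ⟨by omega, by omega⟩, ?_⟩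
        have h2 := (hpred (pred x) (by omega)).2
        rw [Finset.mem_erase]
        refine ⟨fun h => ?_, by simp [hadj]⟩
        rw [← h] at h2
        omega
    calc #(distBall G (r + 1 + 1) v) ≤ #(distBall G (r + 1) v) * G.maxDegree := by
          refine (Finset.card_le_card hcov).trans (Finset.card_biUnion_le_card_mul _ _ _ ?_)
          intro u hu
          have hadj := (hpred u (mem_distBall.mp hu).1).1
          rw [Finset.card_erase_of_mem (by simp [hadj.symm]), Finset.card_insert_of_notMem (by simp),
            G.card_neighborFinset_eq_degree]
          simpa using G.degree_le_maxDegree u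
      _ ≤ G.degree v * G.maxDegree ^ r * G.maxDegree := by gcongr
      _ = _ := by ring

end Balls

section Labelling

/-- Every graph of large maximum degree and at least polylogarithmic minimum degree has a vertex
labelling in which each label is fairly represented in all neighbourhoods and balls. -/
theorem exists_balanced_labelling (r M : ℕ) (hr : 1 ≤ r) (hM : 0 < M) (ξ : ℝ) (hξ0 : 0 < ξ)
    (hξ1 : ξ < 1) :
    ∃ Δ₀ : ℝ, ∀ (V : Type) [Fintype V] [DecidableEq V] (G : SimpleGraph V) [DecidableRel G.Adj],
      Δ₀ ≤ (G.maxDegree : ℝ) → (Real.log G.maxDegree) ^ 8 ≤ (G.minDegree : ℝ) →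
      ∃ lab : V → Fin M, ∀ v i,
        (1 - ξ) * G.degree v / M ≤ #{u ∈ G.neighborFinset v | lab u = i} ∧
        (#{u ∈ distBall G r v | lab u = i} : ℝ) ≤
          (1 + ξ) * (G.degree v * (G.maxDegree : ℝ) ^ (r - 1)) / M := by
  obtain ⟨k, rfl⟩ : ∃ k, r = k + 1 := ⟨r - 1, by omega⟩
  simp only [Nat.add_sub_cancel]
  have hMR : (0 : ℝ) < M := by exact_mod_cast hM
  set c₁ := (1 - (1 - ξ) + (1 - ξ) * Real.log (1 - ξ)) / M with hc₁
  set c₂ := (1 - (1 + ξ) + (1 + ξ) * Real.log (1 + ξ)) / M with hc₂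
  have hc₁0 : 0 < c₁ := div_pos (one_sub_add_mul_log_pos (by linarith) (by linarith)) hMR
  have hc₂0 : 0 < c₂ := div_pos (one_sub_add_mul_log_pos (by linarith) (by linarith)) hMR
  set c := min c₁ c₂ with hc
  have hc0 : 0 < c := lt_min hc₁0 hc₂0
  set L₀ := max 1 ((Real.log (32 * M) + 2 * (k + 1)) / c) with hL₀
  refine ⟨Real.exp L₀, ?_⟩
  intro V _ _ G _ hΔ hδ
  have : NeZero M := ⟨hM.ne'⟩
  set Δ : ℝ := (G.maxDegree : ℝ) with hΔdef
  have hΔ0 : 0 < Δ := (Real.exp_pos _).trans_le hΔ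
  set L := Real.log Δ with hL
  have hL₀L : L₀ ≤ L := (Real.le_log_iff_exp_le hΔ0).mpr hΔ
  have hL1 : 1 ≤ L := (le_max_left _ _).trans hL₀L
  have hΔ1 : 1 ≤ Δ := by
    by_contra h
    have := Real.log_neg hΔ0 (not_le.mp h)
    linarith
  have hΔexp : Δ = Real.exp L := (Real.exp_log hΔ0).symm
  let bad : V → Finset (V → Fin M) := fun v => univ.filter fun f => ∃ i,
    (#{u ∈ G.neighborFinset v | f u = i} : ℝ) < (1 - ξ) * G.degree v / M ∨
    (1 + ξ) * (G.degree v * Δ ^ k) / M < #{u ∈ distBall G (k + 1) v | f u = i}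
  let T : V → Finset V := fun v => insert v (distBall G (k + 1) v)
  have hTN : ∀ v, G.neighborFinset v ⊆ T v := by
    intro v u hu
    rw [SimpleGraph.mem_neighborFinset, ← SimpleGraph.dist_eq_one_iff_adj] at hu
    exact mem_insert_of_mem (mem_distBall.mpr ⟨by omega, by omega⟩)
  have hTsymm : ∀ u v, u ∈ T v → v ∈ T u := by
    intro u v h
    rcases mem_insert.mp h with rfl | h
    · exact mem_insert_self _ _
    · exact mem_insert_of_mem (mem_distBall_comm.mp h)
  have hTcard : ∀ v, #(T v) ≤ 2 * G.maxDegree ^ (k + 1) := by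
    intro v
    have h1 := card_distBall_le G k v
    have h2 : G.degree v * G.maxDegree ^ k ≤ G.maxDegree ^ (k + 1) := by
      rw [pow_succ']; gcongr; exact G.degree_le_maxDegree v
    have h3 : 1 ≤ G.maxDegree ^ (k + 1) := by
      apply Nat.one_le_pow
      exact Nat.cast_pos.mp (hΔdef ▸ hΔ0)
    have h4 : #(T v) ≤ #(distBall G (k + 1) v) + 1 := Finset.card_insert_le _ _
    omega
  have hdeg : ∀ v, L ^ 8 ≤ G.degree v := fun v =>
    hδ.trans (by exact_mod_cast G.minDegree_le_degree v)
  have hbad : ∀ v, (#(bad v) : ℝ) ≤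
      2 * M * Real.exp (-(c * L ^ 8)) * Fintype.card (V → Fin M) := by
    intro v
    have hcov : bad v ⊆ univ.biUnion fun i : Fin M =>
        (univ.filter fun f : V → Fin M => (1 - ξ) ^ ((1 - ξ) * G.degree v / M) ≤
          (1 - ξ) ^ (#{u ∈ G.neighborFinset v | f u = i} : ℝ)) ∪
        (univ.filter fun f : V → Fin M => (1 + ξ) ^ ((1 + ξ) * (G.degree v * Δ ^ k) / M) ≤
          (1 + ξ) ^ (#{u ∈ distBall G (k + 1) v | f u = i} : ℝ)) := by
      intro f hf
      obtain ⟨i, hi⟩ := (mem_filter.mp hf).2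
      refine mem_biUnion.mpr ⟨i, mem_univ _, mem_union.mpr (hi.imp ?_ ?_)⟩
      · intro h
        exact mem_filter.mpr ⟨mem_univ _, Real.rpow_le_rpow_of_exponent_ge (by linarith)
          (by linarith) h.le⟩
      · intro h
        exact mem_filter.mpr ⟨mem_univ _, Real.rpow_le_rpow_of_exponent_le (by linarith) h.le⟩
    have hlow : ∀ i : Fin M, (#{f : V → Fin M | (1 - ξ) ^ ((1 - ξ) * G.degree v / M) ≤
        (1 - ξ) ^ (#{u ∈ G.neighborFinset v | f u = i} : ℝ)} : ℝ) ≤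
        Real.exp (-(c * L ^ 8)) * Fintype.card (V → Fin M) := by
      intro i
      refine (card_filter_rpow_le hM (G.neighborFinset v) i (by linarith) (m := G.degree v)
        (by simp)).trans ?_
      rw [← hc₁]
      have : c * L ^ 8 ≤ c₁ * G.degree v := by
        gcongr
        · exact min_le_left _ _
        · exact hdeg v
      gcongr
    have hupp : ∀ i : Fin M, (#{f : V → Fin M | (1 + ξ) ^ ((1 + ξ) * (G.degree v * Δ ^ k) / M) ≤
        (1 + ξ) ^ (#{u ∈ distBall G (k + 1) v | f u = i} : ℝ)} : ℝ) ≤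
        Real.exp (-(c * L ^ 8)) * Fintype.card (V → Fin M) := by
      intro i
      have hb : (#(distBall G (k + 1) v) : ℝ) ≤ G.degree v * Δ ^ k := by
        rw [hΔdef]; exact_mod_cast card_distBall_le G k v
      refine (card_filter_rpow_le hM (distBall G (k + 1) v) i (by linarith)
        (m := G.degree v * Δ ^ k) (by
          have : 0 ≤ 1 + ξ - 1 := by linarith
          gcongr)).trans ?_
      rw [← hc₂]
      have h1 : (G.degree v : ℝ) ≤ G.degree v * Δ ^ k :=
        le_mul_of_one_le_right (Nat.cast_nonneg _) (one_le_pow₀ hΔ1)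
      have : c * L ^ 8 ≤ c₂ * (G.degree v * Δ ^ k) := by
        gcongr
        · exact min_le_right _ _
        · exact (hdeg v).trans h1
      gcongr
    have h1 : (#(bad v) : ℝ) ≤ ∑ _i : Fin M,
        (2 * (Real.exp (-(c * L ^ 8)) * Fintype.card (V → Fin M))) := by
      refine (Nat.cast_le.mpr ((Finset.card_le_card hcov).trans Finset.card_biUnion_le)).trans ?_
      rw [Nat.cast_sum]
      refine Finset.sum_le_sum fun i _ => ?_
      refine (Nat.cast_le.mpr (Finset.card_union_le _ _)).trans ?_
      rw [Nat.cast_add, two_mul]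
      exact add_le_add (hlow i) (hupp i)
    refine h1.trans_eq ?_
    simp
    ring
  obtain ⟨f, hf⟩ := exists_forall_notMem_of_local bad T (by
      intro v f g hfg hf
      obtain ⟨i, hi⟩ := (mem_filter.mp hf).2
      refine mem_filter.mpr ⟨mem_univ _, i, ?_⟩
      have h1 : (G.neighborFinset v).filter (fun u => f u = i) =
          (G.neighborFinset v).filter (fun u => g u = i) :=
        Finset.filter_congr fun u hu => by rw [hfg u (hTN v hu)]
      have h2 : (distBall G (k + 1) v).filter (fun u => f u = i) =
          (distBall G (k + 1) v).filter (fun u => g u = i) :=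
        Finset.filter_congr fun u hu => by rw [hfg u (mem_insert_of_mem hu)]
      rwa [h1, h2] at hi)
    (2 * M * Real.exp (-(c * L ^ 8))) ((2 * Δ ^ (k + 1)) * (2 * Δ ^ (k + 1))) (by positivity)
    hbad (by
      have : 1 ≤ Δ ^ (k + 1) := one_le_pow₀ hΔ1
      nlinarith) (by
      intro v
      have hsub : (univ.filter fun j => ¬ Disjoint (T v) (T j)) ⊆ (T v).biUnion T := by
        intro j hj
        obtain ⟨u, hu, huj⟩ := Finset.not_disjoint_iff.mp (mem_filter.mp hj).2
        exact mem_biUnion.mpr ⟨u, hu, hTsymm _ _ huj⟩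
      have h := (Finset.card_le_card hsub).trans
        (Finset.card_biUnion_le_card_mul _ _ _ fun u _ => hTcard u)
      have h' := h.trans (Nat.mul_le_mul_right _ (hTcard v))
      rw [hΔdef]
      exact_mod_cast h') (by
      have h1 : Δ ^ (k + 1) = Real.exp ((k + 1) * L) := by
        rw [hΔexp, ← Real.exp_nat_mul]; simp
      have h32 : (0 : ℝ) < 32 * M := by positivity
      have h2 : 4 * (2 * M * Real.exp (-(c * L ^ 8))) * ((2 * Δ ^ (k + 1)) * (2 * Δ ^ (k + 1))) =
          Real.exp (Real.log (32 * M) + 2 * ((k + 1) * L) - c * L ^ 8) := by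
        rw [Real.exp_sub, Real.exp_add, Real.exp_log h32, h1, Real.exp_neg,
          two_mul ((k + 1 : ℝ) * L), Real.exp_add]
        ring
      rw [h2, Real.exp_le_one_iff]
      have h3 : Real.log (32 * M) + 2 * (k + 1) ≤ c * L := by
        rw [← div_le_iff₀' hc0]
        exact (le_max_right _ _).trans hL₀L
      have h4 : L * L ≤ L ^ 8 := by
        rw [← pow_two]; exact pow_le_pow_right₀ hL1 (by norm_num)
      have h5 : 0 ≤ Real.log (32 * M) := Real.log_nonneg (by
        have : (1 : ℝ) ≤ M := by exact_mod_cast hM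
        linarith)
      have h6 := mul_le_mul_of_nonneg_right h3 (zero_le_one.trans hL1)
      have h7 := mul_le_mul_of_nonneg_left h4 hc0.le
      have h8 : Real.log (32 * M) ≤ Real.log (32 * M) * L := le_mul_of_one_le_right h5 hL1
      linarith)
  refine ⟨f, fun v i => ?_⟩
  have := hf v
  simp only [bad, mem_filter, mem_univ, true_and, not_exists, not_or, not_lt] at this
  exact this i

end Labelling

section Shifts

variable {V : Type*} [DecidableEq V]

theorem exists_subset_sum_sign_eq {ι : Type*} (B : Finset ι) (η : ι → ℤ) (m : ℤ)
    (h1 : -(#{w ∈ B | η w = -1} : ℤ) ≤ m)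
    (h2 : m ≤ #{w ∈ B | η w = 1}) : ∃ U ⊆ B, ∑ w ∈ U, η w = m := by
  rcases le_total 0 m with hm | hm
  · obtain ⟨U, hU, hcard⟩ := Finset.exists_subset_card_eq (s := {w ∈ B | η w = 1}) (n := m.toNat)
      (by omega)
    refine ⟨U, hU.trans (Finset.filter_subset _ _), ?_⟩
    rw [Finset.sum_congr rfl fun w hw => (mem_filter.mp (hU hw)).2]
    simp [hcard, hm]
  · obtain ⟨U, hU, hcard⟩ := Finset.exists_subset_card_eq (s := {w ∈ B | η w = -1})
      (n := (-m).toNat) (by omega)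
    refine ⟨U, hU.trans (Finset.filter_subset _ _), ?_⟩
    rw [Finset.sum_congr rfl fun w hw => (mem_filter.mp (hU hw)).2]
    simp [hcard]
    omega

/-- Adding `η w` along the edges `aw`, `w ∈ U`. -/
def starShift (a : V) (U : Finset V) (η : V → ℤ) (e : Sym2 V) : ℤ :=
  ∑ w ∈ U, if e = s(a, w) then η w else 0

theorem starShift_mk {a w : V} {U : Finset V} (η : V → ℤ) (hw : w ∈ U) :
    starShift a U η s(a, w) = η w := by
  rw [starShift, Finset.sum_eq_single w]
  · simp
  · intro b _ hb
    rw [if_neg]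
    simp [hb.symm]
    grind
  · exact fun h => absurd hw h

theorem starShift_eq_zero {a : V} {U : Finset V} {η : V → ℤ} {e : Sym2 V}
    (h : ∀ w ∈ U, e ≠ s(a, w)) : starShift a U η e = 0 :=
  Finset.sum_eq_zero fun w hw => if_neg (h w hw)

variable [Fintype V] (G : SimpleGraph V) [DecidableRel G.Adj]

theorem sum_starShift_center {a : V} {U : Finset V} (η : V → ℤ) (hU : U ⊆ G.neighborFinset a) :
    ∑ x ∈ G.neighborFinset a, starShift a U η s(a, x) = ∑ w ∈ U, η w := by
  rw [← Finset.sum_subset hU]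
  · exact Finset.sum_congr rfl fun w hw => starShift_mk η hw
  · intro x _ hxU
    refine starShift_eq_zero fun w hw h => hxU ?_
    rw [Sym2.eq_iff] at h
    grind

theorem sum_starShift_of_ne {a v : V} {U : Finset V} (η : V → ℤ) (hU : U ⊆ G.neighborFinset a)
    (hv : v ≠ a) :
    ∑ x ∈ G.neighborFinset v, starShift a U η s(v, x) = if v ∈ U then η v else 0 := by
  split_ifs with hvU
  · have hadj : G.Adj a v := by simpa using hU hvU
    rw [Finset.sum_eq_single_of_mem a (by simpa using hadj.symm)]
    · rw [Sym2.eq_swap, starShift_mk η hvU]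
    · intro x _ hx
      refine starShift_eq_zero fun w hw h => ?_
      rw [Sym2.eq_iff] at h
      grind
  · refine Finset.sum_eq_zero fun x _ => starShift_eq_zero fun w hw h => ?_
    rw [Sym2.eq_iff] at h
    grind

/-- Each vertex `v` owns the edges towards `B v`, along which it may alter its own value while
keeping every other value within its pair `{2i, 2i + 1}`; processing the vertices one by one
yields values lying in admissible pairs that avoid the pairs of all conflicting vertices. -/
theorem exists_unit_shifts (B C : V → Finset V) (hB : ∀ v, B v ⊆ G.neighborFinset v)
    (hasymm : ∀ v w, w ∈ B v → v ∉ B w) (rank : V → ℕ) (hC : ∀ v, ∀ u ∈ C v, rank u < rank v)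
    (J₀ : V → ℤ) (Ok : V → ℤ → Prop)
    (hchoice : ∀ v, ∀ t : ℤ, ∀ F : Finset ℤ, #F ≤ #(C v) →
      ∃ J, t ≤ J ∧ J ≤ t + #(B v) ∧ Ok v (J / 2) ∧ J / 2 ∉ F) :
    ∃ σ : Sym2 V → ℤ, (∀ e, -1 ≤ σ e ∧ σ e ≤ 1) ∧ ∀ v,
      Ok v ((J₀ v + ∑ w ∈ G.neighborFinset v, σ s(v, w)) / 2) ∧
      ∀ u ∈ C v, (J₀ u + ∑ w ∈ G.neighborFinset u, σ s(u, w)) / 2 ≠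
        (J₀ v + ∑ w ∈ G.neighborFinset v, σ s(v, w)) / 2 := by
  let J : (Sym2 V → ℤ) → V → ℤ := fun σ v => J₀ v + ∑ w ∈ G.neighborFinset v, σ s(v, w)
  suffices h : ∀ P : Finset V, ∃ σ : Sym2 V → ℤ, (∀ e, -1 ≤ σ e ∧ σ e ≤ 1) ∧
      (∀ v ∉ P, ∀ w ∈ B v, σ s(v, w) = 0) ∧
      ∀ v ∈ P, Ok v (J σ v / 2) ∧ ∀ u ∈ C v, u ∈ P → J σ u / 2 ≠ J σ v / 2 by
    obtain ⟨σ, hσ, _, h⟩ := h univ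
    exact ⟨σ, hσ, fun v => ⟨(h v (mem_univ _)).1, fun u hu => (h v (mem_univ _)).2 u hu (mem_univ _)⟩⟩
  intro P
  induction P using Finset.induction_on_max_value rank with
  | empty => exact ⟨0, by simp⟩
  | insert a P ha hmax ih =>
    obtain ⟨σ, hσ, hunused, hP⟩ := ih
    let η : V → ℤ := fun w => if J σ w % 2 = 0 then 1 else -1
    have hη : ∀ w, η w = 1 ∨ η w = -1 := fun w => by
      by_cases h : J σ w % 2 = 0
      exacts [Or.inl (if_pos h), Or.inr (if_neg h)]
    have hpair : ∀ w, (J σ w + η w) / 2 = J σ w / 2 := fun w => by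
      by_cases h : J σ w % 2 = 0
      · simp only [η, h, if_true]; omega
      · simp only [η, h, if_false]; omega
    have hsplit : (#{w ∈ B a | η w = 1} : ℤ) + #{w ∈ B a | η w = -1} = #(B a) := by
      have h1 := Finset.card_filter_add_card_filter_not (s := B a) (fun w => η w = 1)
      have h2 : (B a).filter (fun w => ¬ η w = 1) = (B a).filter fun w => η w = -1 :=
        Finset.filter_congr fun w _ => by
          rcases hη w with h | h <;> rw [h] <;> norm_num
      rw [h2] at h1
      exact_mod_cast h1
    obtain ⟨j, hj1, hj2, hjok, hjF⟩ := hchoice a (J σ a - #{w ∈ B a | η w = -1})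
      ((C a).image fun u => J σ u / 2) Finset.card_image_le
    obtain ⟨U, hUB, hU⟩ := exists_subset_sum_sign_eq (B a) η (j - J σ a)
      (by omega) (by omega)
    have hUN := hUB.trans (hB a)
    let σ' : Sym2 V → ℤ := fun e => σ e + starShift a U η e
    have hJa : J σ' a = j := by
      simp only [J, σ', Finset.sum_add_distrib, sum_starShift_center G η hUN, hU]
      ring
    have hJ : ∀ v, v ≠ a → J σ' v / 2 = J σ v / 2 := by
      intro v hv
      have : J σ' v = J σ v + if v ∈ U then η v else 0 := by
        simp only [J, σ', Finset.sum_add_distrib, sum_starShift_of_ne G η hUN hv]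
        ring
      rw [this]
      split_ifs
      · exact hpair v
      · rw [add_zero]
    refine ⟨σ', fun e => ?_, fun v hv w hw => ?_, fun v hv => ?_⟩
    · by_cases h : ∃ w ∈ U, e = s(a, w)
      · obtain ⟨w, hw, rfl⟩ := h
        simp only [σ', starShift_mk η hw, hunused a ha w (hUB hw)]
        rcases hη w with h | h <;> rw [h] <;> norm_num
      · push Not at h
        simpa only [σ', starShift_eq_zero h, add_zero] using hσ e
    · rw [mem_insert, not_or] at hv
      simp only [σ']
      rw [hunused v hv.2 w hw, starShift_eq_zero, add_zero]
      intro x hx h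
      rw [Sym2.eq_iff] at h
      rcases h with h | h
      · exact hv.1 h.1
      · exact hasymm v w hw (h.1 ▸ h.2 ▸ hUB hx)
    · have hCne : ∀ u ∈ C v, u ≠ v := fun u hu h => by
        have := hC v u hu; rw [h] at this; omega
      rcases eq_or_ne v a with rfl | hva
      · rw [hJa]
        refine ⟨hjok, fun u hu _ h => hjF (mem_image.mpr ⟨u, hu, ?_⟩)⟩
        rw [← h, hJ u (hCne u hu)]
      · have hvP := Finset.mem_of_mem_insert_of_ne hv hva
        rw [hJ v hva]
        refine ⟨(hP v hvP).1, fun u hu hu' => ?_⟩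
        have hua : u ≠ a := fun h => by
          have h1 := hC v u hu
          have h2 := hmax v hvP
          rw [h] at h1
          omega
        rw [hJ u hua]
        exact (hP v hvP).2 u hu (Finset.mem_of_mem_insert_of_ne hu' hua)

end Shifts

section Arithmetic

theorem exists_mem_Icc_notMem {lo hi : ℕ} {F : Finset ℕ} (h : lo + #F ≤ hi) :
    ∃ y, lo ≤ y ∧ y ≤ hi ∧ y ∉ F := by
  obtain ⟨y, hy, hyF⟩ := Finset.exists_mem_notMem_of_card_lt_card (s := F) (t := Icc lo hi)
    (by rw [Nat.card_Icc]; omega)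
  rw [mem_Icc] at hy
  exact ⟨y, hy.1, hy.2, hyF⟩

/-- Distinct elements of `[1, W]`, each avoiding few prescribed values, can be chosen to have any
prescribed sum in a long interval. -/
theorem exists_injOn_sum_eq {ι : Type*} [DecidableEq ι] {W : ℕ} (s : Finset ι) (hs : 2 ≤ #s)
    (F : ι → Finset ℕ) (b : ℕ) (hF : ∀ i ∈ s, #(F i) ≤ b) (hW : 8 * (b + #s) ≤ W) (T : ℕ)
    (hT1 : #s * W ≤ 4 * T) (hT2 : 4 * T ≤ 3 * (#s * W)) :
    ∃ y : ι → ℕ, (∀ i ∈ s, 1 ≤ y i ∧ y i ≤ W ∧ y i ∉ F i) ∧ Set.InjOn y s ∧ ∑ i ∈ s, y i = T := by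
  induction s using Finset.induction_on generalizing F b T with
  | empty => simp at hs
  | insert i s hi ih =>
    rw [Finset.card_insert_of_notMem hi] at hs hW hT1 hT2
    have hFi := hF i (mem_insert_self _ _)
    rcases (by omega : #s = 1 ∨ 2 ≤ #s) with h1 | h2
    · obtain ⟨j, rfl⟩ := Finset.card_eq_one.mp h1
      rw [mem_singleton] at hi
      have hFj := hF j (by simp)
      rw [h1] at hW hT1 hT2
      have himg : #((F j).image fun z => T - z) ≤ b := Finset.card_image_le.trans hFj
      have hcard : #(F i ∪ (F j).image (fun z => T - z) ∪ {T / 2}) ≤ 2 * b + 1 := by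
        refine (Finset.card_union_le _ _).trans ?_
        have := Finset.card_union_le (F i) ((F j).image fun z => T - z)
        rw [card_singleton]
        omega
      obtain ⟨y, hy1, hy2, hy3⟩ := exists_mem_Icc_notMem (lo := max 1 (T - W))
        (hi := min W (T - 1)) (F := F i ∪ (F j).image (fun z => T - z) ∪ {T / 2}) (by omega)
      simp only [mem_union, mem_image, mem_singleton, not_or, not_exists, not_and] at hy3
      refine ⟨fun k => if k = i then y else T - y, ?_, ?_, ?_⟩
      · intro k hk
        rcases mem_insert.mp hk with rfl | hk
        · simp only [if_true]
          exact ⟨by omega, by omega, hy3.1.1⟩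
        · rw [mem_singleton] at hk
          subst hk
          simp only [if_neg (Ne.symm hi)]
          exact ⟨by omega, by omega, fun h => hy3.1.2 _ h (by omega)⟩
      · rw [Finset.coe_insert, Finset.coe_singleton, Set.injOn_pair]
        simp only [if_true, if_neg (Ne.symm hi)]
        omega
      · rw [Finset.sum_pair hi]
        simp only [if_true, if_neg (Ne.symm hi)]
        omega
    · have hfW : 2 * W ≤ #s * W := Nat.mul_le_mul_right _ h2
      rw [add_mul, one_mul] at hT1 hT2
      obtain ⟨y₀, h1, h2, h3⟩ := exists_mem_Icc_notMem (F := F i)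
        (lo := max 1 (T - 3 * (#s * W) / 4)) (hi := min W (T - (#s * W + 3) / 4)) (by omega)
      obtain ⟨y, hy, hyinj, hysum⟩ := ih (by omega) (fun j => insert y₀ (F j)) (b + 1)
        (fun j hj => (Finset.card_insert_le _ _).trans
          (Nat.add_le_add_right (hF j (mem_insert_of_mem hj)) 1))
        (by omega) (T - y₀) (by omega) (by omega)
      have hne : ∀ j ∈ s, j ≠ i := fun j hj h => hi (h ▸ hj)
      have hy' : ∀ j ∈ s, y j ≠ y₀ := fun j hj h => (hy j hj).2.2 (h ▸ mem_insert_self _ _)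
      refine ⟨fun k => if k = i then y₀ else y k, ?_, ?_, ?_⟩
      · intro k hk
        rcases mem_insert.mp hk with rfl | hk
        · simp only [if_true]
          exact ⟨by omega, by omega, h3⟩
        · simp only [if_neg (hne k hk)]
          exact ⟨(hy k hk).1, (hy k hk).2.1, fun h => (hy k hk).2.2 (mem_insert_of_mem h)⟩
      · rw [Finset.coe_insert, Set.injOn_insert (by exact_mod_cast hi)]
        refine ⟨fun k hk l hl h => ?_, ?_⟩
        · simp only [if_neg (hne k hk), if_neg (hne l hl)] at h
          exact hyinj hk hl h
        · rintro ⟨k, hk, h⟩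
          simp only [if_neg (hne k hk), if_true] at h
          exact hy' k hk h
      · rw [Finset.sum_insert hi, if_pos rfl, Finset.sum_congr rfl fun k hk => if_neg (hne k hk),
          hysum]
        omega

theorem exists_add_mod_eq (lo c q N : ℕ) (hq : q < N) :
    ∃ T, lo ≤ T ∧ T < lo + N ∧ (c + T) % N = q := by
  have hN : 0 < N := by omega
  have hr := Nat.mod_lt (c + lo) hN
  refine ⟨lo + (q + (N - (c + lo) % N)) % N, by omega, ?_, ?_⟩
  · have := Nat.mod_lt (q + (N - (c + lo) % N)) hN
    omega
  · rw [← add_assoc, Nat.add_mod_mod, ← Nat.mod_add_mod]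
    have : (c + lo) % N + (q + (N - (c + lo) % N)) = q + N := by omega
    rw [this, Nat.add_mod_right, Nat.mod_eq_of_lt hq]

theorem exists_fiber_mul_le {ι : Type*} (s : Finset ι) (g : ι → ℕ) {N : ℕ} (hN : 0 < N) :
    ∃ q < N, N * #{u ∈ s | g u % N = q} ≤ #s := by
  have h : ∑ q ∈ range N, N * #{u ∈ s | g u % N = q} ≤ ∑ q ∈ range N, #s := by
    rw [← Finset.mul_sum, ← Finset.card_eq_sum_card_fiberwise
      (fun u _ => by simpa using Nat.mod_lt _ hN)]
    simp
  obtain ⟨q, hq, h⟩ := Finset.exists_le_of_sum_le (by simpa using hN.ne') h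
  exact ⟨q, mem_range.mp hq, h⟩

end Arithmetic

section Colouring

variable {V : Type*} [Fintype V] [DecidableEq V]

/-- `x` is a proper colouring of the edges in `E`. -/
def ProperOn (E : Finset (Sym2 V)) (x : Sym2 V → ℕ) : Prop :=
  ∀ e₁ ∈ E, ∀ e₂ ∈ E, e₁ ≠ e₂ → (∃ v, v ∈ e₁ ∧ v ∈ e₂) → x e₁ ≠ x e₂

theorem ProperOn.insert_update {E : Finset (Sym2 V)} {x : Sym2 V → ℕ} (hx : ProperOn E x)
    {e : Sym2 V} (he : e ∉ E) {y : ℕ} (hy : y ∉ {f ∈ E | ∃ v, v ∈ e ∧ v ∈ f}.image x) :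
    ProperOn (insert e E) (Function.update x e y) := by
  have hy' : ∀ f ∈ E, (∃ v, v ∈ e ∧ v ∈ f) → y ≠ x f := fun f hf hv h =>
    hy (mem_image.mpr ⟨f, mem_filter.mpr ⟨hf, hv⟩, h.symm⟩)
  have hneE : ∀ f ∈ E, f ≠ e := fun f hf h => he (by rwa [← h])
  intro e₁ h₁ e₂ h₂ hne hv
  rw [mem_insert] at h₁ h₂
  rcases h₁ with rfl | h₁ <;> rcases h₂ with rfl | h₂
  · exact absurd rfl hne
  · rw [Function.update_self, Function.update_of_ne hne.symm]
    exact hy' e₂ h₂ hv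
  · rw [Function.update_self, Function.update_of_ne hne]
    exact (hy' e₁ h₁ (by simpa only [and_comm] using hv)).symm
  · rw [Function.update_of_ne (hneE _ h₁), Function.update_of_ne (hneE _ h₂)]
    exact hx e₁ h₁ e₂ h₂ hne hv

variable (G : SimpleGraph V) [DecidableRel G.Adj]

theorem card_adjacent_edges_le {E : Finset (Sym2 V)} (hE : E ⊆ G.edgeFinset) (e : Sym2 V) :
    #{f ∈ E | ∃ v, v ∈ e ∧ v ∈ f} ≤ 2 * G.maxDegree := by
  induction e using Sym2.ind with
  | h a b =>
    have hsub : E.filter (fun f => ∃ v, v ∈ s(a, b) ∧ v ∈ f) ⊆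
        G.incidenceFinset a ∪ G.incidenceFinset b := by
      intro f hf
      obtain ⟨hf, v, hv, hvf⟩ := mem_filter.mp hf
      have hfE := SimpleGraph.mem_edgeFinset.mp (hE hf)
      rw [mem_union, SimpleGraph.mem_incidenceFinset, SimpleGraph.mem_incidenceFinset]
      rcases Sym2.mem_iff.mp hv with rfl | rfl
      exacts [Or.inl ⟨hfE, hvf⟩, Or.inr ⟨hfE, hvf⟩]
    refine (Finset.card_le_card hsub).trans ((Finset.card_union_le _ _).trans ?_)
    rw [G.card_incidenceFinset_eq_degree, G.card_incidenceFinset_eq_degree, two_mul]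
    exact add_le_add (G.degree_le_maxDegree a) (G.degree_le_maxDegree b)

theorem exists_properOn {E : Finset (Sym2 V)} (hE : E ⊆ G.edgeFinset) :
    ∃ x : Sym2 V → ℕ, (∀ e ∈ E, 1 ≤ x e ∧ x e ≤ 2 * G.maxDegree + 1) ∧ ProperOn E x := by
  induction E using Finset.induction_on with
  | empty => exact ⟨0, by simp, fun e he => absurd he (Finset.notMem_empty e)⟩
  | insert e E he ih =>
    have hE' := (Finset.subset_insert e E).trans hE
    obtain ⟨x, hx, hproper⟩ := ih hE'
    obtain ⟨y, hy1, hy2, hy⟩ := exists_mem_Icc_notMem (lo := 1) (hi := 2 * G.maxDegree + 1)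
      (F := {f ∈ E | ∃ v, v ∈ e ∧ v ∈ f}.image x) (by
        have := Finset.card_image_le (s := {f ∈ E | ∃ v, v ∈ e ∧ v ∈ f}) (f := x)
        have := card_adjacent_edges_le G hE' e
        omega)
    refine ⟨Function.update x e y, fun f hf => ?_, hproper.insert_update he hy⟩
    rcases mem_insert.mp hf with rfl | hf
    · simpa using ⟨hy1, hy2⟩
    · rw [Function.update_of_ne (fun h => he (by rwa [← h]))]
      exact hx f hf

end Colouring

section Residues

variable {V : Type*} [Fintype V] [DecidableEq V] (G : SimpleGraph V) [DecidableRel G.Adj]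

/-- The sum of the labels of the edges at `v`. -/
def vertexSum (x : Sym2 V → ℕ) (v : V) : ℕ := ∑ w ∈ G.neighborFinset v, x s(v, w)

variable {G}

theorem vertexSum_congr {x x' : Sym2 V → ℕ} {v : V} (h : ∀ e, v ∈ e → x' e = x e) :
    vertexSum G x' v = vertexSum G x v :=
  Finset.sum_congr rfl fun w _ => h _ (Sym2.mem_mk_left v w)

theorem vertexSum_update {x : Sym2 V → ℕ} {e : Sym2 V} (he : e ∈ G.edgeSet) {v : V} (hv : v ∈ e)
    (y : ℕ) : vertexSum G (Function.update x e y) v =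
      vertexSum G (Function.update x e 0) v + y := by
  obtain ⟨w, rfl⟩ := Sym2.mem_iff_exists.mp hv
  have hw : w ∈ G.neighborFinset v := by simpa using he
  have key : ∀ z, vertexSum G (Function.update x s(v, w) z) v =
      z + ∑ u ∈ (G.neighborFinset v).erase w, x s(v, u) := fun z => by
    rw [vertexSum, ← Finset.add_sum_erase _ _ hw, Function.update_self]
    congr 1
    refine Finset.sum_congr rfl fun u hu => Function.update_of_ne (fun h => ?_) _ _
    exact (mem_erase.mp hu).1 (Sym2.congr_right.mp h)
  rw [key, key]
  ring

/-- Relabel the edges of a star. -/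
theorem exists_relabel_star {β : Type*} (x : Sym2 V → β) (a : V) (s : Finset V) (y : V → β) :
    ∃ x' : Sym2 V → β, (∀ w ∈ s, x' s(a, w) = y w) ∧
      ∀ e, (∀ w ∈ s, e ≠ s(a, w)) → x' e = x e := by
  classical
  refine ⟨fun e => if h : ∃ w ∈ s, e = s(a, w) then y h.choose else x e, fun w hw => ?_,
    fun e he => dif_neg fun ⟨w, hw, h⟩ => he w hw h⟩
  have h : ∃ w' ∈ s, s(a, w) = s(a, w') := ⟨w, hw, rfl⟩
  simp only [dif_pos h]
  rw [← Sym2.congr_right.mp h.choose_spec.2]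

/-- The edges meeting `A` can be properly coloured so that each vertex of `A` shares its sum modulo
`N` with at most the average number of its earlier conflicting vertices. -/
theorem exists_balanced_residues (A : Finset V) (rank : V → ℕ) (C : V → Finset V)
    (hC : ∀ a ∈ A, ∀ u ∈ C a, u ∈ A ∧ rank u < rank a) {W N : ℕ} (hN : 0 < N)
    (hout : ∀ a ∈ A, 2 ≤ #{w ∈ G.neighborFinset a | w ∉ A})
    (hlong : ∀ a ∈ A, 2 * N ≤ #{w ∈ G.neighborFinset a | w ∉ A} * W)
    (hW : 24 * G.maxDegree ≤ W) (hW' : 2 * G.maxDegree + 1 ≤ W) :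
    ∃ x : Sym2 V → ℕ, (∀ e ∈ {e ∈ G.edgeFinset | ∃ v ∈ e, v ∈ A}, 1 ≤ x e ∧ x e ≤ W) ∧
      ProperOn {e ∈ G.edgeFinset | ∃ v ∈ e, v ∈ A} x ∧
      ∀ a ∈ A, N * #{u ∈ C a | vertexSum G x u % N = vertexSum G x a % N} ≤ #(C a) := by
  suffices H : ∀ P ⊆ A, ∃ x : Sym2 V → ℕ,
      (∀ e ∈ {e ∈ G.edgeFinset | (∀ v ∈ e, v ∈ A) ∨ ∃ v ∈ e, v ∈ P}, 1 ≤ x e ∧ x e ≤ W) ∧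
      ProperOn {e ∈ G.edgeFinset | (∀ v ∈ e, v ∈ A) ∨ ∃ v ∈ e, v ∈ P} x ∧
      ∀ a ∈ P, N * #{u ∈ C a | vertexSum G x u % N = vertexSum G x a % N} ≤ #(C a) by
    obtain ⟨x, h1, h2, h3⟩ := H A Subset.rfl
    have hsub : ∀ e ∈ {e ∈ G.edgeFinset | ∃ v ∈ e, v ∈ A},
        e ∈ {e ∈ G.edgeFinset | (∀ v ∈ e, v ∈ A) ∨ ∃ v ∈ e, v ∈ A} := fun e he => by
      rw [mem_filter] at he ⊢
      exact ⟨he.1, Or.inr he.2⟩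
    exact ⟨x, fun e he => h1 e (hsub e he),
      fun e₁ h₁ e₂ h₂ => h2 e₁ (hsub e₁ h₁) e₂ (hsub e₂ h₂), h3⟩
  intro P hPA
  induction P using Finset.induction_on_max_value rank with
  | empty =>
    obtain ⟨x, h1, h2⟩ := exists_properOn G (Finset.filter_subset
      (fun e => (∀ v ∈ e, v ∈ A) ∨ ∃ v ∈ e, v ∈ (∅ : Finset V)) G.edgeFinset)
    exact ⟨x, fun e he => ⟨(h1 e he).1, (h1 e he).2.trans hW'⟩, h2, by simp⟩
  | insert a P haP hrank ih =>
    obtain ⟨x, hx1, hx2, hx3⟩ := ih ((Finset.subset_insert a P).trans hPA)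
    have haA : a ∈ A := hPA (mem_insert_self a P)
    set E := {e ∈ G.edgeFinset | (∀ v ∈ e, v ∈ A) ∨ ∃ v ∈ e, v ∈ P} with hE
    set s := {w ∈ G.neighborFinset a | w ∉ A} with hs
    have hsd : #s ≤ G.maxDegree :=
      (Finset.card_filter_le _ _).trans (by simpa using G.degree_le_maxDegree a)
    obtain ⟨z, hz, hzC⟩ := exists_fiber_mul_le (C a) (vertexSum G x) hN
    obtain ⟨T, hT1, hT2, hT3⟩ := exists_add_mod_eq ((#s * W + 3) / 4)
      (∑ w ∈ {w ∈ G.neighborFinset a | w ∈ A}, x s(a, w)) z N hz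
    have hlong' : 2 * N ≤ #s * W := hlong a haA
    obtain ⟨y, hy, hyinj, hysum⟩ := exists_injOn_sum_eq (W := W) s (hout a haA)
      (fun w => {f ∈ E | ∃ v, v ∈ s(a, w) ∧ v ∈ f}.image x) (2 * G.maxDegree)
      (fun w _ => Finset.card_image_le.trans
        (card_adjacent_edges_le G (Finset.filter_subset _ _) _))
      (by omega) T (by omega) (by omega)
    obtain ⟨x', hx's, hx'⟩ := exists_relabel_star x a s y
    have hyF : ∀ w ∈ s, ∀ f ∈ E, (∃ v, v ∈ s(a, w) ∧ v ∈ f) → y w ≠ x f := fun w hw f hf hv h =>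
      (hy w hw).2.2 (mem_image.mpr ⟨f, mem_filter.mpr ⟨hf, hv⟩, h.symm⟩)
    have hcases : ∀ e ∈ {e ∈ G.edgeFinset | (∀ v ∈ e, v ∈ A) ∨ ∃ v ∈ e, v ∈ insert a P},
        (∃ w ∈ s, e = s(a, w)) ∨ (e ∈ E ∧ x' e = x e) := by
      intro e he
      by_cases h : ∃ w ∈ s, e = s(a, w)
      · exact Or.inl h
      push Not at h
      refine Or.inr ⟨?_, hx' e h⟩
      rw [mem_filter] at he
      rw [hE, mem_filter]
      refine ⟨he.1, ?_⟩
      rcases he.2 with h' | ⟨v, hve, hv⟩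
      · exact Or.inl h'
      rcases mem_insert.mp hv with rfl | hv
      · obtain ⟨w, rfl⟩ := Sym2.mem_iff_exists.mp hve
        have hw : w ∈ A := by
          by_contra hw
          exact h w (mem_filter.mpr ⟨by simpa using he.1, hw⟩) rfl
        left
        intro u hu
        rcases Sym2.mem_iff.mp hu with rfl | rfl
        exacts [haA, hw]
      · exact Or.inr ⟨v, hve, hv⟩
    have hS : ∀ u ∈ A, u ≠ a → vertexSum G x' u = vertexSum G x u := fun u hu hua =>
      vertexSum_congr fun e hue => hx' e fun w hw h => by
        subst h
        rcases Sym2.mem_iff.mp hue with rfl | rfl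
        · exact hua rfl
        · exact (mem_filter.mp hw).2 hu
    have hSa : vertexSum G x' a % N = z := by
      rw [← hT3, ← hysum, vertexSum,
        ← Finset.sum_filter_add_sum_filter_not (G.neighborFinset a) (· ∈ A)]
      congr 2
      · refine Finset.sum_congr rfl fun w hw => hx' _ fun w' hw' h => ?_
        rw [Sym2.congr_right] at h
        subst h
        exact (mem_filter.mp hw').2 (mem_filter.mp hw).2
      · exact Finset.sum_congr rfl hx's
    refine ⟨x', fun e he => ?_, fun e₁ h₁ e₂ h₂ hne hv => ?_, fun b hb => ?_⟩
    · rcases hcases e he with ⟨w, hw, rfl⟩ | ⟨h, h'⟩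
      · rw [hx's w hw]
        exact ⟨(hy w hw).1, (hy w hw).2.1⟩
      · rw [h']
        exact hx1 e h
    · rcases hcases e₁ h₁ with ⟨w₁, hw₁, rfl⟩ | ⟨h₁, h₁'⟩ <;>
        rcases hcases e₂ h₂ with ⟨w₂, hw₂, rfl⟩ | ⟨h₂, h₂'⟩
      · rw [hx's _ hw₁, hx's _ hw₂]
        exact fun h => hne (by rw [hyinj hw₁ hw₂ h])
      · rw [hx's _ hw₁, h₂']
        exact hyF _ hw₁ _ h₂ hv
      · rw [hx's _ hw₂, h₁']
        exact (hyF _ hw₂ _ h₁ (by simpa only [and_comm] using hv)).symm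
      · rw [h₁', h₂']
        exact hx2 e₁ h₁ e₂ h₂ hne hv
    · rcases mem_insert.mp hb with rfl | hbP
      · have : {u ∈ C b | vertexSum G x' u % N = vertexSum G x' b % N} =
            {u ∈ C b | vertexSum G x u % N = z} := by
          refine Finset.filter_congr fun u hu => ?_
          obtain ⟨huA, hur⟩ := hC b haA u hu
          rw [hSa, hS u huA (fun h => (h ▸ hur).false)]
        rw [this]
        exact hzC
      · have hbA := hPA hb
        have hba : b ≠ a := fun h => haP (h ▸ hbP)
        have : {u ∈ C b | vertexSum G x' u % N = vertexSum G x' b % N} =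
            {u ∈ C b | vertexSum G x u % N = vertexSum G x b % N} := by
          refine Finset.filter_congr fun u hu => ?_
          obtain ⟨huA, hur⟩ := hC b hbA u hu
          have := hrank b hbP
          rw [hS b hbA hba, hS u huA (fun h => by subst h; omega)]
        rw [this]
        exact hx3 b hbP

/-- A proper colouring of `E₀` extends to the edges of `X`, coloured one by one, so that few
vertices conflicting with `v` are completed before `v` and share its sum modulo `N`; `τ` records
the time at which a vertex is completed. -/
theorem exists_extension_of_completion_order {E₀ X : Finset (Sym2 V)} (hdisj : Disjoint E₀ X)
    (hE : E₀ ∪ X ⊆ G.edgeFinset) {W N B : ℕ} (hWN : W < N) (x₀ : Sym2 V → ℕ)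
    (hx₀ : ∀ e ∈ E₀, 1 ≤ x₀ e ∧ x₀ e ≤ W) (hx₀' : ProperOn E₀ x₀)
    (Conf : V → Finset V) (hself : ∀ v, v ∉ Conf v) (q : V → ℕ)
    (hq : ∀ e ∈ X, ∀ v ∈ e, 0 < q v ∧ #(Conf v) ≤ B * q v)
    (hW : 2 * G.maxDegree + 2 * B + 1 ≤ W) :
    ∃ (x : Sym2 V → ℕ) (τ : V → ℕ), (∀ e ∈ E₀ ∪ X, 1 ≤ x e ∧ x e ≤ W) ∧ ProperOn (E₀ ∪ X) x ∧
      (∀ e, e ∉ X → x e = x₀ e) ∧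
      ∀ e ∈ X, ∀ v ∈ e,
        #{u ∈ Conf v | τ u ≤ τ v ∧ vertexSum G x u % N = vertexSum G x v % N} ≤ q v := by
  classical
  suffices H : ∀ E ⊆ X, ∃ (x : Sym2 V → ℕ) (τ : V → ℕ),
      (∀ e ∈ E₀ ∪ E, 1 ≤ x e ∧ x e ≤ W) ∧ ProperOn (E₀ ∪ E) x ∧
      (∀ e, e ∉ E → x e = x₀ e) ∧
      ∀ f ∈ X, ∀ v ∈ f, (∀ e ∈ X, v ∈ e → e ∈ E) → τ v ≤ #E ∧
        #{u ∈ Conf v | (∀ e ∈ X, u ∈ e → e ∈ E) ∧ τ u ≤ τ v ∧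
          vertexSum G x u % N = vertexSum G x v % N} ≤ q v by
    obtain ⟨x, τ, h1, h2, h3, h4⟩ := H X Subset.rfl
    refine ⟨x, τ, h1, h2, h3, fun e he v hv => le_trans (Finset.card_le_card ?_)
      (h4 e he v hv fun _ h _ => h).2⟩
    intro u hu
    rw [mem_filter] at hu ⊢
    exact ⟨hu.1, fun _ h _ => h, hu.2⟩
  intro E hEX
  induction E using Finset.induction_on with
  | empty =>
    exact ⟨x₀, 0, by simpa using hx₀, by simpa using hx₀', fun _ _ => rfl,
      fun f hf v hv h => absurd (h f hf hv) (Finset.notMem_empty f)⟩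
  | insert e E heE ih =>
    obtain ⟨x, τ, hx, hproper, hxE, hcount⟩ := ih ((Finset.subset_insert e E).trans hEX)
    have heX : e ∈ X := hEX (mem_insert_self e E)
    have heG : e ∈ G.edgeSet := SimpleGraph.mem_edgeFinset.mp (hE (mem_union_right _ heX))
    have hsubG : E₀ ∪ E ⊆ G.edgeFinset :=
      (Finset.union_subset_union_right ((Finset.subset_insert e E).trans hEX)).trans hE
    set Done : V → Prop := fun u => ∀ f ∈ X, u ∈ f → f ∈ E with hDone
    have hDone_e : ∀ v, Done v → v ∉ e := fun v hv hve => heE (hv e heX hve)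
    set cnt : V → ℕ → Finset V := fun v z => {u ∈ Conf v | Done u ∧ vertexSum G x u % N = z}
      with hcnt
    set bad : V → Finset ℕ := fun v => {z ∈ range N | q v ≤ #(cnt v z)} with hbad
    have hbadcard : ∀ v ∈ e, #(bad v) ≤ B := by
      intro v hv
      obtain ⟨hq0, hqB⟩ := hq e heX v hv
      refine Nat.le_of_mul_le_mul_right (le_trans ?_ hqB) hq0
      calc #(bad v) * q v ≤ ∑ z ∈ bad v, #(cnt v z) := by
            rw [← smul_eq_mul]
            exact Finset.card_nsmul_le_sum _ _ _ fun z hz => (mem_filter.mp hz).2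
        _ = #((bad v).biUnion (cnt v)) := by
            rw [Finset.card_biUnion]
            intro z _ z' _ hzz'
            refine Finset.disjoint_left.mpr fun u hu hu' => hzz' ?_
            exact (mem_filter.mp hu).2.2.symm.trans (mem_filter.mp hu').2.2
        _ ≤ #(Conf v) := Finset.card_le_card
            (Finset.biUnion_subset.mpr fun z _ => Finset.filter_subset _ _)
    set S₀ := vertexSum G (Function.update x e 0) with hS₀
    set forb : V → Finset ℕ := fun v => {y ∈ Icc 1 W | (S₀ v + y) % N ∈ bad v} with hforb
    have hforbcard : ∀ v ∈ e, #(forb v) ≤ B := by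
      intro v hv
      refine le_trans (Finset.card_le_card_of_injOn (fun y => (S₀ v + y) % N)
        (fun y hy => (mem_filter.mp hy).2) ?_) (hbadcard v hv)
      intro y hy y' hy' h
      have h1 := mem_Icc.mp (mem_filter.mp hy).1
      have h2 := mem_Icc.mp (mem_filter.mp hy').1
      have h3 : y ≡ y' [MOD N] := Nat.ModEq.add_left_cancel' (S₀ v) h
      rwa [Nat.ModEq, Nat.mod_eq_of_lt (by omega), Nat.mod_eq_of_lt (by omega)] at h3
    obtain ⟨y, hy1, hyW, hyF, hyforb⟩ : ∃ y, 1 ≤ y ∧ y ≤ W ∧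
        y ∉ {f ∈ E₀ ∪ E | ∃ v, v ∈ e ∧ v ∈ f}.image x ∧ ∀ v ∈ e, y ∉ forb v := by
      have hadj := (Finset.card_image_le (f := x)).trans (card_adjacent_edges_le G hsubG e)
      obtain ⟨a, b, hab⟩ : ∃ a b, e = s(a, b) := Sym2.ind (fun a b => ⟨a, b, rfl⟩) e
      have ha := hforbcard a (by rw [hab]; exact Sym2.mem_mk_left a b)
      have hb := hforbcard b (by rw [hab]; exact Sym2.mem_mk_right a b)
      have u1 := Finset.card_union_le
        ({f ∈ E₀ ∪ E | ∃ v, v ∈ e ∧ v ∈ f}.image x ∪ forb a) (forb b)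
      have u2 := Finset.card_union_le ({f ∈ E₀ ∪ E | ∃ v, v ∈ e ∧ v ∈ f}.image x) (forb a)
      obtain ⟨y, h1, h2, h3⟩ := exists_mem_Icc_notMem (lo := 1) (hi := W)
        (F := {f ∈ E₀ ∪ E | ∃ v, v ∈ e ∧ v ∈ f}.image x ∪ forb a ∪ forb b) (by omega)
      simp only [mem_union, not_or] at h3
      refine ⟨y, h1, h2, h3.1.1, fun v hv => ?_⟩
      rw [hab] at hv
      rcases Sym2.mem_iff.mp hv with rfl | rfl
      exacts [h3.1.2, h3.2]
    have heE₀ : e ∉ E₀ ∪ E := by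
      rw [mem_union, not_or]
      exact ⟨fun h => Finset.disjoint_left.mp hdisj h heX, heE⟩
    set x' := Function.update x e y with hx'
    have hS : ∀ v, v ∉ e → vertexSum G x' v = vertexSum G x v := fun v hv =>
      vertexSum_congr fun f hvf => Function.update_of_ne (fun h => hv (by rwa [← h])) _ _
    have hSe : ∀ v ∈ e, vertexSum G x' v = S₀ v + y := fun v hv => vertexSum_update heG hv y
    refine ⟨x', fun u => if Done u then τ u else #E + 1, fun f hf => ?_, ?_, fun f hf => ?_,
      fun f hf v hvf hv => ?_⟩
    · rw [Finset.union_insert, mem_insert] at hf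
      rcases hf with rfl | hf
      · rw [hx', Function.update_self]
        exact ⟨hy1, hyW⟩
      · rw [hx', Function.update_of_ne (fun h => heE₀ (by rwa [← h]))]
        exact hx f hf
    · rw [Finset.union_insert]
      exact hproper.insert_update heE₀ hyF
    · rw [mem_insert, not_or] at hf
      rw [hx', Function.update_of_ne hf.1]
      exact hxE f hf.2
    · rw [Finset.card_insert_of_notMem heE]
      by_cases hvD : Done v
      · obtain ⟨hτ, hle⟩ := hcount f hf v hvf hvD
        simp only [if_pos hvD]
        refine ⟨by omega, le_trans (Finset.card_le_card ?_) hle⟩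
        intro u hu
        obtain ⟨huC, -, huτ, huS⟩ := mem_filter.mp hu
        by_cases huD : Done u
        · rw [if_pos huD] at huτ
          rw [hS u (hDone_e u huD), hS v (hDone_e v hvD)] at huS
          exact mem_filter.mpr ⟨huC, huD, huτ, huS⟩
        · rw [if_neg huD] at huτ
          omega
      · simp only [if_neg hvD]
        refine ⟨le_rfl, ?_⟩
        have hve : v ∈ e := by
          by_contra hve
          refine hvD fun g hg hvg => ?_
          rcases mem_insert.mp (hv g hg hvg) with rfl | h
          exacts [absurd hvg hve, h]
        obtain ⟨w, rfl⟩ := Sym2.mem_iff_exists.mp hve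
        have hnb : ¬ q v ≤ #(cnt v ((S₀ v + y) % N)) := fun h =>
          hyforb v hve (mem_filter.mpr ⟨mem_Icc.mpr ⟨hy1, hyW⟩, mem_filter.mpr
            ⟨mem_range.mpr (Nat.mod_lt _ (by omega)), h⟩⟩)
        have hsub : {u ∈ Conf v | (∀ g ∈ X, u ∈ g → g ∈ insert s(v, w) E) ∧
            (if Done u then τ u else #E + 1) ≤ #E + 1 ∧
            vertexSum G x' u % N = vertexSum G x' v % N} ⊆
            insert w (cnt v ((S₀ v + y) % N)) := by
          intro u hu
          obtain ⟨huC, huD', -, huS⟩ := mem_filter.mp hu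
          rw [mem_insert, or_iff_not_imp_left]
          intro huw
          have hue : u ∉ s(v, w) := fun h => by
            rcases Sym2.mem_iff.mp h with rfl | rfl
            exacts [hself _ huC, huw rfl]
          rw [hS u hue, hSe v hve] at huS
          refine mem_filter.mpr ⟨huC, fun g hg hug => ?_, huS⟩
          rcases mem_insert.mp (huD' g hg hug) with rfl | h
          exacts [absurd hug hue, h]
        have h1 := Finset.card_le_card hsub
        have h2 := Finset.card_insert_le w (cnt v ((S₀ v + y) % N))
        exact h1.trans (by omega)

end Residues

section Window

theorem exists_half_not_dvd {m : ℕ} (hm : 0 < m) (t : ℤ) (k : ℕ) (F : Finset ℤ)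
    (h : #F + k / 2 / m + 1 < k / 2) :
    ∃ J, t ≤ J ∧ J ≤ t + k ∧ ¬ (m : ℤ) ∣ J / 2 ∧ J / 2 ∉ F := by
  set L := k / 2 with hL
  set c := (t + 1) / 2 with hc
  have hm' : (0 : ℤ) < m := by exact_mod_cast hm
  have hmult : #{I ∈ Ico c (c + L) | (m : ℤ) ∣ I} ≤ L / m + 1 := by
    refine (Finset.card_le_card (t := (Icc ((c + m - 1) / m) ((c + m - 1) / m + L / m)).image
      fun i => (m : ℤ) * i) fun I hI => ?_).trans (Finset.card_image_le.trans ?_)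
    · obtain ⟨hI, i, rfl⟩ := mem_filter.mp hI
      rw [mem_Ico] at hI
      refine mem_image.mpr ⟨i, mem_Icc.mpr ⟨?_, ?_⟩, rfl⟩
      · have : (c + m - 1) / m < i + 1 := Int.ediv_lt_of_lt_mul hm' (by nlinarith)
        omega
      · have h1 : i ≤ (c + L - 1) / m := by
          rw [Int.le_ediv_iff_mul_le hm']
          nlinarith
        refine h1.trans ?_
        have h2 := Int.lt_ediv_add_one_mul_self (c + m - 1) hm'
        have h3 := Int.lt_ediv_add_one_mul_self (L : ℤ) hm'
        have h4 : (c + L - 1) / m < (c + m - 1) / m + L / m + 1 := by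
          apply Int.ediv_lt_of_lt_mul hm'
          nlinarith
        omega
    · rw [Int.card_Icc]
      have : ((L / m : ℕ) : ℤ) = (L : ℤ) / m := by push_cast; rfl
      have := Int.natCast_nonneg (L / m)
      omega
  obtain ⟨I, hI, hIF⟩ := Finset.exists_mem_notMem_of_card_lt_card
    (s := F ∪ {I ∈ Ico c (c + L) | (m : ℤ) ∣ I}) (t := Ico c (c + L)) (by
      refine (Finset.card_union_le _ _).trans_lt ?_
      rw [Int.card_Ico]
      omega)
  rw [mem_union, mem_filter, not_or, not_and] at hIF
  have hI' := mem_Ico.mp hI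
  refine ⟨2 * I, by omega, by omega, ?_, ?_⟩ <;> rw [Int.mul_ediv_cancel_left _ two_ne_zero]
  exacts [hIF.2 hI, hIF.1]

theorem exists_half_dvd {m : ℕ} (hm : 0 < m) (t : ℤ) (k : ℕ) (F : Finset ℤ)
    (h : #F < k / 2 / m) :
    ∃ J, t ≤ J ∧ J ≤ t + k ∧ (m : ℤ) ∣ J / 2 ∧ J / 2 ∉ F := by
  set L := k / 2 with hL
  set c := (t + 1) / 2 with hc
  have hm' : (0 : ℤ) < m := by exact_mod_cast hm
  set i₀ := (c + m - 1) / m with hi₀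
  obtain ⟨I, hI, hIF⟩ := Finset.exists_mem_notMem_of_card_lt_card
    (s := F) (t := (Ico i₀ (i₀ + (L / m : ℕ))).image fun i => (m : ℤ) * i) (by
      rw [Finset.card_image_of_injective _ (fun a b hab => mul_left_cancel₀ hm'.ne' hab),
        Int.card_Ico]
      omega)
  obtain ⟨i, hi, rfl⟩ := mem_image.mp hI
  rw [mem_Ico] at hi
  have h1 := Int.lt_ediv_add_one_mul_self (c + m - 1) hm'
  have h2 := Int.ediv_mul_le (c + m - 1) hm'.ne'
  have h3 : ((L / m : ℕ) : ℤ) * m ≤ L := by exact_mod_cast Nat.div_mul_le_self L m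
  rw [← hi₀] at h1 h2
  have h4 : i₀ * m ≤ i * m := mul_le_mul_of_nonneg_right hi.1 hm'.le
  have h5 : (i + 1) * m ≤ (i₀ + (L / m : ℕ)) * m := mul_le_mul_of_nonneg_right (by omega) hm'.le
  rw [add_mul] at h1 h5
  rw [add_mul] at h5
  have h6 : (m : ℤ) * i = i * m := mul_comm _ _
  refine ⟨2 * (m * i), by omega, by omega, ?_, ?_⟩ <;> rw [Int.mul_ediv_cancel_left _ two_ne_zero]
  exacts [dvd_mul_right _ _, hIF]

end Window

section Combination

variable {V : Type*} [Fintype V] [DecidableEq V] (G : SimpleGraph V) [DecidableRel G.Adj]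

/-- The neighbours whose edges to `v` are reserved for adjusting the sum at `v`. -/
def lowerNeighbors (lab : V → ℕ) (j p : ℕ) (v : V) : Finset V :=
  {w ∈ G.neighborFinset v | (lab w < lab v ∧ lab v < p) ∨ (lab v < j ∧ p ≤ lab w) ∨
    (p ≤ lab v ∧ j ≤ lab w ∧ lab w < p)}

theorem distSumDistinguishing_of_labelling (r : ℕ) (lab : V → ℕ) {j p m W N B : ℕ} (hjp : j ≤ p)
    (hm : 0 < m) (hWN : W < N) (q : V → ℕ)
    (hout : ∀ v, 2 ≤ #{w ∈ G.neighborFinset v | p ≤ lab w})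
    (hlong : ∀ v, 2 * N ≤ #{w ∈ G.neighborFinset v | p ≤ lab w} * W)
    (hW : 24 * G.maxDegree + 2 * B + 1 ≤ W)
    (hA : ∀ v, lab v < p → ∀ c, N * c ≤ #{u ∈ distBall G r v | lab u ≤ lab v} →
      c + #(lowerNeighbors G lab j p v) / 2 / m + 1 < #(lowerNeighbors G lab j p v) / 2)
    (hR : ∀ v, p ≤ lab v → 0 < q v ∧ q v < #(lowerNeighbors G lab j p v) / 2 / m ∧
      #{u ∈ distBall G r v | p ≤ lab u} ≤ B * q v) :
    DistSumDistinguishing G r (W + 2 * N) := by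
  classical
  set A : Finset V := {v | lab v < p} with hAdef
  have hmemA : ∀ v, v ∈ A ↔ lab v < p := fun v => by simp [hAdef]
  have hmemA' : ∀ v, v ∉ A ↔ p ≤ lab v := fun v => by rw [hmemA, not_lt]
  set idx : V → ℕ := fun v => Fintype.equivFin V v with hidx
  have hidx_lt : ∀ v, idx v < Fintype.card V := fun v => (Fintype.equivFin V v).isLt
  have hidx_inj : Function.Injective idx :=
    Fin.val_injective.comp (Fintype.equivFin V).injective
  have hlex : ∀ (f : V → ℕ) u v, f u * Fintype.card V + idx u < f v * Fintype.card V + idx v →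
      f u ≤ f v := fun f u v h => by
    by_contra! hlt
    have h1 := Nat.mul_le_mul_right (Fintype.card V) hlt
    have h2 := hidx_lt v
    rw [Nat.succ_mul] at h1
    omega
  have hlex' : ∀ (f : V → ℕ) u v, u ≠ v →
      f u * Fintype.card V + idx u ≠ f v * Fintype.card V + idx v := fun f u v huv h => by
    refine huv (hidx_inj ?_)
    have h1 := congrArg (· % Fintype.card V) h
    simpa only [Nat.mul_add_mod', Nat.mod_eq_of_lt (hidx_lt _)] using h1
  have hout_eq : ∀ v, {w ∈ G.neighborFinset v | w ∉ A} = {w ∈ G.neighborFinset v | p ≤ lab w} :=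
    fun v => Finset.filter_congr fun w _ => hmemA' w
  obtain ⟨x₀, hx₀, hx₀', hx₀C⟩ := exists_balanced_residues (G := G) A
    (fun v => lab v * Fintype.card V + idx v)
    (fun a => {u ∈ distBall G r a | u ∈ A ∧
      lab u * Fintype.card V + idx u < lab a * Fintype.card V + idx a})
    (fun a _ u hu => (mem_filter.mp hu).2) (W := W) (N := N) (by omega)
    (fun a _ => by rw [hout_eq]; exact hout a) (fun a _ => by rw [hout_eq]; exact hlong a)
    (by omega) (by omega)
  set E₀ := {e ∈ G.edgeFinset | ∃ v ∈ e, v ∈ A} with hE₀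
  set X := {e ∈ G.edgeFinset | ¬ ∃ v ∈ e, v ∈ A} with hX
  have hunion : E₀ ∪ X = G.edgeFinset := Finset.filter_union_filter_not_eq _ _
  have hXA : ∀ e ∈ X, ∀ v ∈ e, v ∉ A := fun e he v hv hvA => (mem_filter.mp he).2 ⟨v, hv, hvA⟩
  have hXex : ∀ v, v ∉ A → ∃ e ∈ X, v ∈ e := fun v hv => by
    obtain ⟨w, hw⟩ : ({w ∈ G.neighborFinset v | p ≤ lab w}).Nonempty :=
      Finset.card_pos.mp (by have := hout v; omega)
    obtain ⟨hw, hwp⟩ := mem_filter.mp hw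
    refine ⟨s(v, w), mem_filter.mpr ⟨by simpa using hw, ?_⟩, Sym2.mem_mk_left v w⟩
    rintro ⟨u, hu, huA⟩
    rcases Sym2.mem_iff.mp hu with rfl | rfl
    exacts [hv huA, (hmemA' u).mpr hwp huA]
  obtain ⟨x, τ, hx, hproper, hxX, hcount⟩ := exists_extension_of_completion_order (G := G)
    (E₀ := E₀) (X := X) (Finset.disjoint_filter_filter_not _ _ _) hunion.le hWN (B := B) x₀
    hx₀ hx₀' (fun v => {u ∈ distBall G r v | p ≤ lab u})
    (fun v h => notMem_distBall_self (mem_filter.mp h).1) q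
    (fun e he v hv => by
      obtain ⟨h1, -, h2⟩ := hR v ((hmemA' v).mp (hXA e he v hv))
      exact ⟨h1, h2⟩) (by omega)
  set S := vertexSum G x with hS
  have hSA : ∀ v ∈ A, S v = vertexSum G x₀ v := fun v hv =>
    vertexSum_congr fun e hve => hxX e fun he => hXA e he v hve hv
  set rank : V → ℕ := fun v => if v ∈ A then lab v * Fintype.card V + idx v
    else τ v * Fintype.card V + idx v with hrank
  set C : V → Finset V := fun v => {u ∈ distBall G r v | (u ∈ A ↔ v ∈ A) ∧ rank u < rank v ∧
    S u % N = S v % N} with hC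
  have hrank_ne : ∀ u v, u ≠ v → (u ∈ A ↔ v ∈ A) → rank u ≠ rank v := by
    intro u v huv hiff
    by_cases hv : v ∈ A
    · simp only [hrank, if_pos hv, if_pos (hiff.mpr hv)]
      exact hlex' lab u v huv
    · simp only [hrank, if_neg hv, if_neg (mt hiff.mp hv)]
      exact hlex' τ u v huv
  have hCA : ∀ v ∈ A, N * #(C v) ≤ #{u ∈ distBall G r v | lab u ≤ lab v} := by
    intro v hv
    refine le_trans (Nat.mul_le_mul_left N (Finset.card_le_card fun u hu => ?_))
      ((hx₀C v hv).trans (Finset.card_le_card fun u hu => ?_))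
    · obtain ⟨hub, hiff, hr, hres⟩ := mem_filter.mp hu
      have huA := hiff.mpr hv
      simp only [hrank, if_pos hv, if_pos huA] at hr
      rw [hSA u huA, hSA v hv] at hres
      exact mem_filter.mpr ⟨mem_filter.mpr ⟨hub, huA, hr⟩, hres⟩
    · obtain ⟨hub, -, hr⟩ := mem_filter.mp hu
      exact mem_filter.mpr ⟨hub, hlex lab u v hr⟩
  have hCR : ∀ v, v ∉ A → #(C v) ≤ q v := by
    intro v hv
    obtain ⟨e, he, hve⟩ := hXex v hv
    refine (Finset.card_le_card fun u hu => ?_).trans (hcount e he v hve)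
    obtain ⟨hub, hiff, hr, hres⟩ := mem_filter.mp hu
    have huA := mt hiff.mp hv
    simp only [hrank, if_neg hv, if_neg huA] at hr
    exact mem_filter.mpr ⟨mem_filter.mpr ⟨hub, (hmemA' u).mp huA⟩, hlex τ u v hr, hres⟩
  obtain ⟨σ, hσ, hfinal⟩ := exists_unit_shifts G (lowerNeighbors G lab j p) C
    (fun v => Finset.filter_subset _ _)
    (fun v w hw hv => by
      have h1 := (mem_filter.mp hw).2
      have h2 := (mem_filter.mp hv).2
      omega)
    rank (fun v u hu => (mem_filter.mp hu).2.2.1)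
    (fun v => (S v : ℤ) / N + G.degree v)
    (fun v i => if v ∈ A then ¬ (m : ℤ) ∣ i else (m : ℤ) ∣ i)
    (fun v t F hF => by
      by_cases hv : v ∈ A
      · simp only [if_pos hv]
        refine exists_half_not_dvd hm t _ F (lt_of_le_of_lt ?_
          (hA v ((hmemA v).mp hv) #(C v) (hCA v hv)))
        omega
      · simp only [if_neg hv]
        exact exists_half_dvd hm t _ F
          ((hF.trans (hCR v hv)).trans_lt (hR v ((hmemA' v).mp hv)).2.1))
  have hxe : ∀ e ∈ G.edgeSet, 1 ≤ x e ∧ x e ≤ W := fun e he =>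
    hx e (by rw [hunion]; exact SimpleGraph.mem_edgeFinset.mpr he)
  refine ⟨fun e => x e + N * (1 + σ e).toNat, fun e he => ?_, fun e₁ h₁ e₂ h₂ hne hv h => ?_,
    fun u v hpos hle h => ?_⟩
  · have h1 := hxe e he
    have h2 : (1 + σ e).toNat ≤ 2 := by have := hσ e; omega
    have h3 := Nat.mul_le_mul_left N h2
    dsimp only
    exact ⟨by omega, by omega⟩
  · have h' := congrArg (· % N) h
    have hb₁ := hxe e₁ h₁
    have hb₂ := hxe e₂ h₂
    simp only [Nat.add_mul_mod_self_left] at h'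
    rw [Nat.mod_eq_of_lt (by omega), Nat.mod_eq_of_lt (by omega)] at h'
    refine hproper e₁ ?_ e₂ ?_ hne hv h' <;> rw [hunion] <;>
      exact SimpleGraph.mem_edgeFinset.mpr (by assumption)
  · have hsum : ∀ v, ((∑ w ∈ G.neighborFinset v, (x s(v, w) + N * (1 + σ s(v, w)).toNat) : ℕ) : ℤ)
        = S v + N * (G.degree v + ∑ w ∈ G.neighborFinset v, σ s(v, w)) := by
      intro v
      have : ∀ w ∈ G.neighborFinset v, ((x s(v, w) + N * (1 + σ s(v, w)).toNat : ℕ) : ℤ) =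
          x s(v, w) + (N + N * σ s(v, w)) := fun w _ => by
        have := hσ s(v, w)
        rw [Nat.cast_add, Nat.cast_mul, Int.toNat_of_nonneg (by omega)]
        ring
      rw [Nat.cast_sum, Finset.sum_congr rfl this, Finset.sum_add_distrib, Finset.sum_add_distrib,
        Finset.sum_const, ← Finset.mul_sum, G.card_neighborFinset_eq_degree, hS, vertexSum]
      push_cast
      rw [nsmul_eq_mul]
      ring
    have h' := congrArg (Nat.cast (R := ℤ)) h
    rw [hsum, hsum] at h'
    have hN : (N : ℤ) ≠ 0 := by
      have : N ≠ 0 := by omega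
      exact_mod_cast this
    have hres : S u % N = S v % N := by
      have := congrArg (· % (N : ℤ)) h'
      simp only [Int.add_mul_emod_self_left] at this
      exact_mod_cast this
    have hJ : (S u : ℤ) / N + G.degree u + ∑ w ∈ G.neighborFinset u, σ s(u, w) =
        (S v : ℤ) / N + G.degree v + ∑ w ∈ G.neighborFinset v, σ s(v, w) := by
      have := congrArg (· / (N : ℤ)) h'
      simp only [Int.add_mul_ediv_left _ _ hN] at this
      linarith
    have hu := (hfinal u).1
    have hv := (hfinal v).1
    have hne : u ≠ v := fun h => by
      rw [h, SimpleGraph.dist_self] at hpos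
      exact hpos.false
    by_cases hiff : u ∈ A ↔ v ∈ A
    · have hvu : v ∈ distBall G r u := mem_distBall.mpr ⟨hpos, hle⟩
      rcases lt_or_gt_of_ne (hrank_ne u v hne hiff) with hlt | hlt
      · refine (hfinal v).2 u (mem_filter.mpr ⟨mem_distBall_comm.mp hvu, hiff, hlt, hres⟩) ?_
        rw [hJ]
      · refine (hfinal u).2 v (mem_filter.mpr ⟨hvu, hiff.symm, hlt, hres.symm⟩) ?_
        rw [hJ]
    · rw [hJ] at hu
      by_cases huA : u ∈ A
      · have hvA : v ∉ A := fun h => hiff (by simp [huA, h])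
        rw [if_pos huA] at hu
        rw [if_neg hvA] at hv
        exact hu hv
      · have hvA : v ∈ A := by
          by_contra h
          exact hiff (by simp [huA, h])
        rw [if_neg huA] at hu
        rw [if_pos hvA] at hv
        exact hv hu

end Combination

section Constants

theorem card_filter_Ico_ge {ι : Type*} {s : Finset ι} {f : ι → ℕ} {a b : ℕ} {x : ℝ}
    (h : ∀ i ∈ Ico a b, x ≤ #{u ∈ s | f u = i}) :
    ((b - a : ℕ) : ℝ) * x ≤ #{u ∈ s | a ≤ f u ∧ f u < b} := by
  have hcard : #{u ∈ s | a ≤ f u ∧ f u < b} = ∑ i ∈ Ico a b, #{u ∈ s | f u = i} := by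
    rw [Finset.card_eq_sum_card_fiberwise (f := f) (t := Ico a b)
      (fun u hu => by simpa using (mem_filter.mp hu).2)]
    refine Finset.sum_congr rfl fun i hi => ?_
    rw [Finset.filter_filter]
    congr 1
    refine Finset.filter_congr fun u _ => ⟨fun h => h.2, fun h => ⟨?_, h⟩⟩
    rw [h]
    exact mem_Ico.mp hi
  rw [hcard, Nat.cast_sum, ← Nat.card_Ico, ← nsmul_eq_mul]
  exact Finset.card_nsmul_le_sum _ _ _ h

theorem card_filter_Ico_le {ι : Type*} {s : Finset ι} {f : ι → ℕ} {a b : ℕ} {x : ℝ}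
    (h : ∀ i ∈ Ico a b, (#{u ∈ s | f u = i} : ℝ) ≤ x) :
    (#{u ∈ s | a ≤ f u ∧ f u < b} : ℝ) ≤ ((b - a : ℕ) : ℝ) * x := by
  have hsub : {u ∈ s | a ≤ f u ∧ f u < b} ⊆ s := Finset.filter_subset _ _
  rw [Finset.card_eq_sum_card_fiberwise (f := f) (t := Ico a b)
      (fun u hu => by simpa using (mem_filter.mp hu).2), Nat.cast_sum, ← Nat.card_Ico,
      ← nsmul_eq_mul]
  refine Finset.sum_le_card_nsmul _ _ _ fun i hi => (h i hi).trans' ?_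
  exact_mod_cast Finset.card_le_card (Finset.filter_subset_filter _ hsub)

theorem conflicts_lt_window {t X c L N K : ℝ} (ht0 : 0 < t) (ht : 16 * t ≤ 1) (hX : 2 ≤ X * t)
    (hL : X * (1 - t) ≤ L) (hK : 0 < K) (hN : 2 * K * (1 + 8 * t) ≤ N) (hc : 0 ≤ c)
    (hNc : N * c ≤ X * (1 + t) ^ 2 * K) : c + L / 2 * t + 3 / 2 < L / 2 := by
  have hX0 : 0 < X := by
    by_contra! h
    nlinarith
  have h1 : 2 * (1 + 8 * t) * c ≤ X * (1 + t) ^ 2 := by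
    refine le_of_mul_le_mul_right ?_ hK
    calc 2 * (1 + 8 * t) * c * K = 2 * K * (1 + 8 * t) * c := by ring
      _ ≤ N * c := mul_le_mul_of_nonneg_right hN hc
      _ ≤ _ := hNc
  have h2 : X * (1 - t) * (1 - t) ≤ L * (1 - t) := mul_le_mul_of_nonneg_right hL (by linarith)
  have h3 : X * (1 + t) ^ 2 + 6 ≤ X * (1 - t) * (1 - t) * (1 + 8 * t) := by
    have : 3 * (X * t) ≤ X * t * (4 - 16 * t + 8 * t ^ 2) := by nlinarith [mul_pos hX0 ht0]
    nlinarith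
  have h4 : (1 + 8 * t) * (2 * c + 3) < (1 + 8 * t) * (L * (1 - t)) := by
    have := mul_le_mul_of_nonneg_right h2 (by linarith : 0 ≤ 1 + 8 * t)
    nlinarith
  have h5 := lt_of_mul_lt_mul_left h4 (by linarith)
  linarith

end Constants

section Main

theorem exists_forall_distSumDistinguishing (r : ℕ) (n : ℕ) (hr : 4 ≤ r) (hn : 16 ≤ n) :
    ∃ Δ₀ : ℝ, ∀ (V : Type) [Fintype V] [DecidableEq V],
      ∀ (G : SimpleGraph V) [DecidableRel G.Adj],
      Δ₀ ≤ (G.maxDegree : ℝ) →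
      (Real.log G.maxDegree) ^ 8 ≤ (G.minDegree : ℝ) →
      DistSumDistinguishing G r ((G.maxDegree ^ (r - 1) / n + 1) +
          2 * (2 * G.maxDegree ^ (r - 1) + 16 * (G.maxDegree ^ (r - 1) / n + 1))) ∧
        33 * n ≤ G.maxDegree ^ (r - 1) := by
  set M := 256 * n ^ 3 with hM
  have hn3 : 256 * n ≤ n ^ 3 := by
    have : 16 * 16 ≤ n * n := Nat.mul_le_mul hn hn
    calc 256 * n ≤ n * n * n := Nat.mul_le_mul_right n this
      _ = n ^ 3 := by ring
  have hnM : 65536 * n ≤ M := by omega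
  have hnR : (16 : ℝ) ≤ n := by exact_mod_cast hn
  have hn0 : (0 : ℝ) < n := by linarith
  have hMR : (M : ℝ) = 256 * (n : ℝ) ^ 3 := by rw [hM]; push_cast; ring
  have hM0 : (0 : ℝ) < M := by rw [hMR]; positivity
  set t : ℝ := 1 / n with ht
  have htn : t * n = 1 := by rw [ht]; field_simp
  have ht0 : 0 < t := by positivity
  have ht16 : 16 * t ≤ 1 := by nlinarith
  obtain ⟨Δ₁, hΔ₁⟩ := exists_balanced_labelling r M (by omega) (by omega) t ht0 (by linarith)
  refine ⟨max Δ₁ (Real.exp (16 * M)), fun V _ _ G _ hΔ hδ => ?_⟩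
  obtain ⟨lab, hlab⟩ := hΔ₁ V G ((le_max_left _ _).trans hΔ) hδ
  set D := G.maxDegree with hD
  set K := D ^ (r - 1) with hK
  have hM1 : (1 : ℝ) ≤ 16 * M := by
    have : 1 ≤ 16 * M := by omega
    exact_mod_cast this
  have hlog : (16 * M : ℝ) ≤ Real.log D := by
    rw [Real.le_log_iff_exp_le ((Real.exp_pos _).trans_le ((le_max_right _ _).trans hΔ))]
    exact (le_max_right _ _).trans hΔ
  have hminR : (16 * M : ℝ) ≤ G.minDegree := by
    refine (hlog.trans ?_).trans hδ
    exact le_self_pow₀ (hM1.trans hlog) (by norm_num)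
  have hmin : 16 * M ≤ G.minDegree := by exact_mod_cast hminR
  have hdeg : ∀ v, 16 * M ≤ G.degree v := fun v => hmin.trans (G.minDegree_le_degree v)
  have hDM : 16 * M ≤ D := by
    by_contra! h
    have : (D : ℝ) < 16 * M := by exact_mod_cast h
    have h2 := Real.log_le_self (Nat.cast_nonneg (α := ℝ) D)
    linarith
  have hKD : 16 * M * D ≤ K := by
    calc 16 * M * D ≤ D * D := Nat.mul_le_mul_right D hDM
      _ = D ^ 2 := (sq D).symm
      _ ≤ D ^ (r - 1) := Nat.pow_le_pow_right (by omega) (by omega)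
  have hMD : 16 * M ≤ 16 * M * D := Nat.le_mul_of_pos_right _ (by omega)
  have hKn : 33 * n ≤ K := by omega
  refine ⟨?_, hKn⟩
  set W := K / n + 1 with hW
  have hWn : K ≤ n * W := by
    have := Nat.lt_mul_div_succ K (by omega : 0 < n)
    rw [hW]
    omega
  have hWK : 16 * W ≤ K + 16 := by
    have h1 := Nat.div_le_div_left hn (by norm_num) (a := K)
    have h2 := Nat.mul_div_le K 16
    omega
  set N := 2 * K + 16 * W with hN
  set B := K / (8 * n) with hB
  have hB8 : 8 * n * B ≤ K := Nat.mul_div_le K (8 * n)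
  have hB8' : K < 8 * n * (B + 1) := Nat.lt_mul_div_succ K (by omega)
  set lab' : V → ℕ := fun v => lab v with hlab'
  have hfib : ∀ (s : Finset V) (i : ℕ) (hi : i < M),
      {u ∈ s | lab' u = i} = {u ∈ s | lab u = ⟨i, hi⟩} := fun s i hi =>
    Finset.filter_congr fun u _ => (Fin.ext_iff (b := ⟨i, hi⟩)).symm
  have hlow : ∀ v, ∀ a b, b ≤ M → ((b - a : ℕ) : ℝ) * ((1 - t) * G.degree v / M) ≤
      #{u ∈ G.neighborFinset v | a ≤ lab' u ∧ lab' u < b} := fun v a b hb =>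
    card_filter_Ico_ge fun i hi => by
      rw [hfib _ i ((mem_Ico.mp hi).2.trans_le hb)]
      exact (hlab v _).1
  have hup : ∀ v, ∀ a b, b ≤ M → (#{u ∈ distBall G r v | a ≤ lab' u ∧ lab' u < b} : ℝ) ≤
      ((b - a : ℕ) : ℝ) * ((1 + t) * (G.degree v * K) / M) := fun v a b hb =>
    card_filter_Ico_le fun i hi => by
      rw [hfib _ i ((mem_Ico.mp hi).2.trans_le hb), hK, Nat.cast_pow]
      exact (hlab v _).2
  have hlt : ∀ v, lab' v < M := fun v => (lab v).isLt
  have htop : ∀ v, (n : ℝ) * ((1 - t) * G.degree v / M) ≤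
      #{w ∈ G.neighborFinset v | M - n ≤ lab' w} := fun v => by
    have h := hlow v (M - n) M le_rfl
    rw [Nat.sub_sub_self (by omega)] at h
    simpa only [hlt, and_true] using h
  have hd16 : ∀ v, (16 : ℝ) ≤ G.degree v / M := fun v => by
    rw [le_div_iff₀ hM0]
    exact_mod_cast hdeg v
  have hsize : ∀ v, 8 * n ≤ #{w ∈ G.neighborFinset v | M - n ≤ lab' w} := fun v => by
    have h := htop v
    have h' : (8 : ℝ) * n ≤ n * ((1 - t) * G.degree v / M) := by
      rw [mul_comm, mul_div_assoc]
      have := hd16 v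
      exact mul_le_mul_of_nonneg_left (by nlinarith) hn0.le
    exact_mod_cast h'.trans h
  have hlower : ∀ v, M - n ≤ lab' v →
      G.degree v ≤ 2 * #(lowerNeighbors G lab' n (M - n) v) := fun v hv => by
    have h := hlow v n (M - n) (Nat.sub_le _ _)
    have hsub : #{u ∈ G.neighborFinset v | n ≤ lab' u ∧ lab' u < M - n} ≤
        #(lowerNeighbors G lab' n (M - n) v) :=
      Finset.card_le_card fun w hw => by
        rw [mem_filter] at hw
        exact mem_filter.mpr ⟨hw.1, Or.inr (Or.inr ⟨hv, hw.2⟩)⟩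
    have hsub' : (#{u ∈ G.neighborFinset v | n ≤ lab' u ∧ lab' u < M - n} : ℝ) ≤
        #(lowerNeighbors G lab' n (M - n) v) := by exact_mod_cast hsub
    have h1 : (3 / 4 * M : ℝ) ≤ (M - n - n : ℕ) := by
      have : 3 * M ≤ 4 * (M - n - n) := by omega
      have : (3 * M : ℝ) ≤ 4 * (M - n - n : ℕ) := by exact_mod_cast this
      linarith
    have h2 : (3 / 4 * M : ℝ) * (15 / 16 * G.degree v / M) ≤
        (M - n - n : ℕ) * ((1 - t) * G.degree v / M) := by
      refine mul_le_mul h1 ?_ (by positivity) (by positivity)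
      gcongr
      linarith
    have h3 : (3 / 4 * M : ℝ) * (15 / 16 * G.degree v / M) = 45 / 64 * G.degree v := by
      field_simp
      ring
    have h4 : (0 : ℝ) ≤ G.degree v := Nat.cast_nonneg _
    have h5 : (G.degree v : ℝ) ≤ 2 * #(lowerNeighbors G lab' n (M - n) v) := by linarith
    exact_mod_cast h5
  have hK0 : (0 : ℝ) < K := by
    have : 0 < K := by omega
    exact_mod_cast this
  refine distSumDistinguishing_of_labelling G r lab' (j := n) (p := M - n) (m := n) (B := B)
    (by omega) (by omega) (by omega)
    (fun v => #(lowerNeighbors G lab' n (M - n) v) / 2 / n - 1)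
    (fun v => (hsize v).trans' (by omega)) (fun v => ?_) ?_ (fun v hv c hc => ?_) (fun v hv => ?_)
  · have h1 := Nat.mul_le_mul_right W (hsize v)
    rw [mul_assoc] at h1
    omega
  · have h1 : 65536 * (n * D) ≤ M * D := by
      rw [← mul_assoc]
      exact Nat.mul_le_mul_right D hnM
    have h2 : n * (24 * D + 2 * B + 1) ≤ n * W := by
      have h3 : n * (24 * D + 2 * B + 1) = 24 * (n * D) + 2 * (n * B) + n := by ring
      rw [mul_assoc] at hB8 hKD
      omega
    exact Nat.le_of_mul_le_mul_left h2 (by omega)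
  · set L := #(lowerNeighbors G lab' n (M - n) v) with hL
    set a := max (lab' v) n with ha
    have hLa : (a : ℝ) * ((1 - t) * G.degree v / M) ≤ L := by
      rcases le_or_gt n (lab' v) with h | h
      · rw [ha, max_eq_left h]
        refine (hlow v 0 (lab' v) (hlt v).le).trans ?_
        rw [hL]
        exact_mod_cast Finset.card_le_card fun w hw => by
          rw [mem_filter] at hw
          exact mem_filter.mpr ⟨hw.1, Or.inl ⟨hw.2.2, hv⟩⟩
      · rw [ha, max_eq_right h.le]
        refine (htop v).trans ?_
        rw [hL]
        exact_mod_cast Finset.card_le_card fun w hw => by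
          rw [mem_filter] at hw
          exact mem_filter.mpr ⟨hw.1, Or.inr (Or.inl ⟨h, hw.2⟩)⟩
    have han : (n : ℝ) ≤ a := by exact_mod_cast le_max_right _ _
    have hia : ((lab' v + 1 : ℕ) : ℝ) ≤ a * (1 + t) := by
      have h1 : 1 ≤ a * t := by rw [← htn, mul_comm t]; gcongr
      have h2 : (lab' v : ℝ) ≤ a := by exact_mod_cast le_max_left _ _
      push_cast
      linarith
    have hcR : (N : ℝ) * c ≤ (lab' v + 1 : ℕ) * ((1 + t) * (G.degree v * K) / M) := by
      refine le_trans ?_ (hup v 0 (lab' v + 1) (by have := hlt v; omega))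
      simp only [Nat.zero_le, true_and, Nat.lt_succ_iff]
      exact_mod_cast hc
    have key := conflicts_lt_window (t := t) (X := a * (G.degree v / M)) (c := c) (L := L)
      (N := N) (K := K) ht0 ht16 ?_ ?_ hK0 ?_ (Nat.cast_nonneg c) ?_
    · have h1 : ((L / 2 / n : ℕ) : ℝ) ≤ L / 2 * t := by
        rw [ht, mul_one_div]
        exact Nat.cast_div_le.trans (by gcongr; exact Nat.cast_div_le)
      have h2 : (L : ℝ) ≤ 2 * (L / 2 : ℕ) + 1 := by
        have : L ≤ 2 * (L / 2) + 1 := by omega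
        exact_mod_cast this
      have h3 : (c : ℝ) + (L / 2 / n : ℕ) + 1 < (L / 2 : ℕ) := by linarith
      exact_mod_cast h3
    · have := hd16 v
      have h1 : (n : ℝ) * 16 ≤ a * (G.degree v / M) := by gcongr
      nlinarith
    · refine le_trans (le_of_eq ?_) hLa
      ring
    · have h1 : (K : ℝ) ≤ n * W := by exact_mod_cast hWn
      have h2 : (N : ℝ) = 2 * K + 16 * W := by rw [hN]; push_cast; ring
      have h3 : t * K ≤ t * (n * W) := by gcongr
      rw [← mul_assoc, htn] at h3
      linarith
    · refine hcR.trans ?_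
      calc ((lab' v + 1 : ℕ) : ℝ) * ((1 + t) * (G.degree v * K) / M)
          ≤ (a * (1 + t)) * ((1 + t) * (G.degree v * K) / M) := by gcongr
        _ = _ := by ring
  · have hLd := hlower v hv
    have hdv := hdeg v
    set L := #(lowerNeighbors G lab' n (M - n) v) with hL
    have hdiv := Nat.lt_mul_div_succ (L / 2) (by omega : 0 < n)
    have h2 : 2 ≤ L / 2 / n := by
      rw [Nat.le_div_iff_mul_le (by omega)]
      omega
    refine ⟨by omega, by omega, ?_⟩
    obtain ⟨q, hq⟩ : ∃ q, L / 2 / n = q + 1 := ⟨L / 2 / n - 1, by omega⟩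
    rw [hq] at hdiv ⊢
    rw [Nat.add_sub_cancel]
    have hdq : G.degree v ≤ 8 * (n * q) := by
      have : n * (q + 1 + 1) = n * q + 2 * n := by ring
      omega
    have hKB : K ≤ 16 * (n * B) := by
      have : 8 * n * (B + 1) = 8 * (n * B) + 8 * n := by ring
      omega
    have hdK : (G.degree v * K : ℝ) ≤ 8 * (n * q) * (16 * (n * B)) := by
      exact_mod_cast Nat.mul_le_mul hdq hKB
    have hconf := hup v (M - n) M le_rfl
    rw [Nat.sub_sub_self (by omega)] at hconf
    simp only [hlt, and_true] at hconf
    have hfin : (n : ℝ) * ((1 + t) * (G.degree v * K) / M) ≤ B * q := by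
      calc (n : ℝ) * ((1 + t) * (G.degree v * K) / M)
          ≤ n * (2 * (8 * (n * q) * (16 * (n * B))) / M) := by
            gcongr
            linarith
        _ = B * q := by
            rw [hMR]
            field_simp
            ring
    exact_mod_cast hconf.trans hfin

theorem distSumDistIndex_le_of_minDegree_ge (r : ℕ) (hr : 4 ≤ r) (ε : ℝ) (hε : 0 < ε) :
    ∃ Δ₀ : ℝ, ∀ (V : Type) [Fintype V] [DecidableEq V],
      ∀ (G : SimpleGraph V) [DecidableRel G.Adj],
      Δ₀ ≤ (G.maxDegree : ℝ) →
      (Real.log G.maxDegree) ^ 8 ≤ (G.minDegree : ℝ) →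
      (distSumDistIndex G r : ℝ) ≤ (4 + ε) * (G.maxDegree : ℝ) ^ (r - 1) := by
  obtain ⟨n₀, hn₀⟩ := exists_nat_ge (34 / ε)
  set n := max n₀ 16 with hn
  have hn16 : 16 ≤ n := le_max_right _ _
  have hn0 : (0 : ℝ) < n := by exact_mod_cast (by omega : 0 < n)
  have hnε : 34 ≤ n * ε := by
    rw [div_le_iff₀ hε] at hn₀
    have : (n₀ : ℝ) ≤ n := by exact_mod_cast le_max_left _ _
    nlinarith
  obtain ⟨Δ₀, h⟩ := exists_forall_distSumDistinguishing r n hr hn16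
  refine ⟨Δ₀, fun V _ _ G _ hΔ hδ => ?_⟩
  obtain ⟨hdist, hK⟩ := h V G hΔ hδ
  set K := G.maxDegree ^ (r - 1) with hKdef
  have hle : distSumDistIndex G r ≤ K / n + 1 + 2 * (2 * K + 16 * (K / n + 1)) := Nat.sInf_le hdist
  have hleR : (distSumDistIndex G r : ℝ) ≤ 4 * K + 33 * (K / n : ℕ) + 33 := by
    have : distSumDistIndex G r ≤ 4 * K + 33 * (K / n) + 33 := by omega
    exact_mod_cast this
  have h1 : ((K / n : ℕ) : ℝ) ≤ K / n := Nat.cast_div_le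
  have hKR : (33 : ℝ) * n ≤ K := by exact_mod_cast hK
  have h2 : (33 : ℝ) ≤ K / n := by rwa [le_div_iff₀ hn0]
  have h3 : 34 * (K / n : ℝ) ≤ ε * K := by
    rw [mul_div_assoc', div_le_iff₀ hn0]
    nlinarith [Nat.cast_nonneg (α := ℝ) K]
  have h4 : ((G.maxDegree : ℝ)) ^ (r - 1) = K := by rw [hKdef, Nat.cast_pow]
  rw [h4]
  linarith

end Main
end

section
/- Let G be a graph without isolated edges and with maximum degree Δ ≥ 2, and let r ≥ 4 be an integer. Then the r-distant sum distinguishing index satisfies χ'_{Σ,r}(G) ≤ 6·Δ^{r-1}. -/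
open Finset

namespace DistSum

variable {V : Type*} [Fintype V] [DecidableEq V] (G : SimpleGraph V) [DecidableRel G.Adj]

/-- The sum of the colours of the edges at `w`. -/
def vertexSum (c : Sym2 V → ℤ) (w : V) : ℤ := ∑ y ∈ G.neighborFinset w, c s(w, y)

variable {G}

theorem vertexSum_of_adj {c c' : Sym2 V → ℤ} {w y : V} (h : ∀ e, w ∉ e → c' e = c e)
    (hy : G.Adj w y) :
    vertexSum G c' y = vertexSum G c y + (c' s(w, y) - c s(w, y)) := by
  have hw : w ∈ G.neighborFinset y := by simpa using hy.symm
  rw [vertexSum, vertexSum, ← Finset.add_sum_erase _ _ hw, ← Finset.add_sum_erase _ _ hw]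
  have : ∑ x ∈ (G.neighborFinset y).erase w, c' s(y, x)
      = ∑ x ∈ (G.neighborFinset y).erase w, c s(y, x) := by
    refine Finset.sum_congr rfl fun x hx => h _ ?_
    have := hy.ne
    have := Finset.ne_of_mem_erase hx
    simp only [Sym2.mem_iff]
    grind
  rw [this, Sym2.eq_swap (a := y)]
  ring

theorem vertexSum_of_not_adj {c c' : Sym2 V → ℤ} {w y : V} (h : ∀ e, w ∉ e → c' e = c e)
    (hne : y ≠ w) (hy : ¬ G.Adj w y) : vertexSum G c' y = vertexSum G c y := by
  refine Finset.sum_congr rfl fun x hx => h _ ?_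
  have hx : G.Adj y x := by simpa using hx
  simp only [Sym2.mem_iff]
  rintro (rfl | rfl)
  · exact hne rfl
  · exact hy hx.symm

theorem vertexSum_update {c : Sym2 V → ℤ} {w y : V} (hy : G.Adj w y) (s : ℤ) :
    vertexSum G (Function.update c s(w, y) s) w = vertexSum G c w - c s(w, y) + s := by
  have h := vertexSum_of_adj (G := G) (c := c) (c' := Function.update c s(w, y) s) (w := y)
    (y := w) (fun e he => Function.update_of_ne (by rintro rfl; simp at he) _ _) hy.symm
  rw [h, Sym2.eq_swap (a := y), Function.update_self]
  ring

theorem vertexSum_update_of_ne {c : Sym2 V → ℤ} {w y x : V} (hw : x ≠ w) (hy : x ≠ y) (s : ℤ) :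
    vertexSum G (Function.update c s(w, y) s) x = vertexSum G c x := by
  refine Finset.sum_congr rfl fun z _ => Function.update_of_ne ?_ _ _
  simp only [ne_eq, Sym2.eq_iff]
  grind

theorem exists_recolouring (c : Sym2 V → ℤ) (w : V) (g : V → ℤ) :
    ∃ c' : Sym2 V → ℤ, (∀ e, w ∉ e → c' e = c e) ∧ ∀ y, c' s(w, y) = g y := by
  classical
  refine ⟨fun e => if h : w ∈ e then g (Sym2.Mem.other h) else c e, fun e he => by simp [he],
    fun y => ?_⟩
  have h : w ∈ s(w, y) := Sym2.mem_mk_left _ _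
  have h' := Sym2.congr_right.1 (Sym2.other_spec h)
  simp only [h, dite_true]
  rw [h']

/-- The level of `s`: the parity of the block of length `K` containing `s`. -/
def level (K s : ℤ) : ℤ := s / K % 2

/-- The smaller of the two elements of the pair `{a, a + K}`, with `a / K` even, containing `s`. -/
def pairMin (K s : ℤ) : ℤ := s - K * level K s

theorem level_eq (K s : ℤ) : level K s = 0 ∨ level K s = 1 := by
  unfold level; omega

theorem eq_pairMin_or (K s : ℤ) : s = pairMin K s ∨ s = pairMin K s + K := by
  rcases level_eq K s with h | h <;> simp [pairMin, h]

theorem pairMin_add {K : ℤ} (hK : 0 < K) (s : ℤ) {τ : ℤ} (hτ : τ = 0 ∨ τ = 1) :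
    pairMin K (s + K * (τ - level K s)) = pairMin K s := by
  have h : level K (s + K * (τ - level K s)) = τ := by
    have h1 : (s + K * (τ - level K s)) / K = s / K + (τ - level K s) :=
      Int.add_mul_ediv_left _ _ hK.ne'
    rw [level, h1]
    unfold level
    omega
  rw [pairMin, h, pairMin]
  ring

/-- Changing the edges between `w` and `Q` by multiples of `K` so that precisely the members of
`T` end on the upper level. -/
theorem exists_set_levels {K : ℤ} (hK : 0 < K) (c : Sym2 V → ℤ) {w : V} {Q T : Finset V}
    (hQ : Q ⊆ G.neighborFinset w) (hT : T ⊆ Q) :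
    ∃ c' : Sym2 V → ℤ, (∀ e, (∀ y ∈ Q, e ≠ s(w, y)) → c' e = c e) ∧
      (∀ y ∈ Q, ∃ τ, -1 ≤ τ ∧ τ ≤ 1 ∧ c' s(w, y) = c s(w, y) + K * τ) ∧
      (∀ y ∈ Q, pairMin K (vertexSum G c' y) = pairMin K (vertexSum G c y)) ∧
      (∀ y, y ≠ w → y ∉ Q → vertexSum G c' y = vertexSum G c y) ∧
      vertexSum G c' w
        = vertexSum G c w + K * (T.card - ∑ y ∈ Q, level K (vertexSum G c y)) := by
  set δ : V → ℤ := fun y =>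
    if y ∈ Q then (if y ∈ T then 1 else 0) - level K (vertexSum G c y) else 0 with hδ
  obtain ⟨c', h1, h2⟩ := exists_recolouring c w fun y => c s(w, y) + K * δ y
  have hadj : ∀ y ∈ Q, G.Adj w y := fun y hy => by simpa using hQ hy
  refine ⟨c', fun e he => ?_, fun y hy => ⟨δ y, ?_, ?_, h2 y⟩, fun y hy => ?_, fun y hw hy => ?_, ?_⟩
  · by_cases hw : w ∈ e
    · obtain ⟨y, rfl⟩ := hw
      have : y ∉ Q := fun hy => he y hy rfl
      simp [h2, hδ, this]
    · exact h1 e hw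
  · rcases level_eq K (vertexSum G c y) with h | h <;> simp only [hδ, h] <;> split_ifs <;> simp
  · rcases level_eq K (vertexSum G c y) with h | h <;> simp only [hδ, h] <;> split_ifs <;> simp
  · rw [vertexSum_of_adj h1 (hadj y hy), h2, add_sub_cancel_left]
    simp only [hδ, hy, if_true]
    exact pairMin_add hK _ (by split_ifs <;> simp)
  · by_cases hwy : G.Adj w y
    · rw [vertexSum_of_adj h1 hwy, h2]
      simp [hδ, hy]
    · exact vertexSum_of_not_adj h1 hw hwy
  · simp only [vertexSum, h2, Finset.sum_add_distrib, ← Finset.mul_sum]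
    congr 2
    rw [hδ, ← Finset.sum_filter]
    have : (G.neighborFinset w).filter (· ∈ Q) = Q := by
      ext y; simpa using fun hy => hadj y hy
    rw [this, Finset.sum_sub_distrib, ← Finset.sum_filter]
    have : Q.filter (· ∈ T) = T := by
      ext y; simpa using fun hy => hT hy
    rw [this]
    simp [vertexSum]

/-- The colours of distinct members of `F` with a common vertex are distinct modulo `K`. -/
def ProperOn (K : ℤ) (F : Set (Sym2 V)) (c : Sym2 V → ℤ) : Prop :=
  ∀ e₁ ∈ F, ∀ e₂ ∈ F, e₁ ≠ e₂ → (∃ v, v ∈ e₁ ∧ v ∈ e₂) → c e₁ % K ≠ c e₂ % K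

theorem ProperOn.congr {K : ℤ} {F : Set (Sym2 V)} {c c' : Sym2 V → ℤ} (h : ProperOn K F c)
    (hc : ∀ e, c' e % K = c e % K) : ProperOn K F c' := fun e₁ h₁ e₂ h₂ hne hv => by
  rw [hc, hc]; exact h e₁ h₁ e₂ h₂ hne hv

theorem injOn_emod (K : ℤ) : Set.InjOn (· % K) (Set.Icc (K + 1) (2 * K)) := by
  intro a ha b hb h
  simp only [Set.mem_Icc] at ha hb
  have h1 : K ∣ a - b := Int.ModEq.dvd (id h.symm : b ≡ a [ZMOD K])
  have := Int.eq_zero_of_abs_lt_dvd h1 (by rw [abs_lt]; constructor <;> linarith)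
  linarith

theorem exists_free_colours {K : ℤ} {F : Set (Sym2 V)} {c : Sym2 V → ℤ} (hF : F ⊆ G.edgeSet)
    (hc : ProperOn K F c) {w y : V} (hwy : G.Adj w y) {S : Finset ℤ}
    (hS : S ⊆ Finset.Icc (K + 1) (2 * K)) :
    ∃ S' ⊆ S, S.card ≤ S'.card + 2 * (G.maxDegree - 1) ∧
      ∀ s ∈ S', ProperOn K (insert s(w, y) F) (Function.update c s(w, y) s) := by
  set A : Finset (Sym2 V) := ((G.neighborFinset w).erase y).image (fun x => s(w, x)) ∪
    ((G.neighborFinset y).erase w).image (fun x => s(y, x)) with hA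
  have hAcard : A.card ≤ 2 * (G.maxDegree - 1) := by
    refine (Finset.card_union_le _ _).trans ?_
    have h1 := Finset.card_image_le (s := (G.neighborFinset w).erase y) (f := fun x => s(w, x))
    have h2 := Finset.card_image_le (s := (G.neighborFinset y).erase w) (f := fun x => s(y, x))
    rw [Finset.card_erase_of_mem (by simpa using hwy), G.card_neighborFinset_eq_degree] at h1
    rw [Finset.card_erase_of_mem (by simpa using hwy.symm), G.card_neighborFinset_eq_degree] at h2
    have := G.degree_le_maxDegree w
    have := G.degree_le_maxDegree y
    omega
  have hmemA : ∀ e ∈ F, e ≠ s(w, y) → (∃ v, v ∈ e ∧ v ∈ s(w, y)) → e ∈ A := by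
    rintro e he hne ⟨v, hv, hv'⟩
    obtain ⟨x, rfl⟩ := hv
    have hx : G.Adj v x := hF he
    rcases Sym2.mem_iff.1 hv' with rfl | rfl
    · refine Finset.mem_union_left _ (Finset.mem_image.2 ⟨x, ?_, rfl⟩)
      simp only [Finset.mem_erase, SimpleGraph.mem_neighborFinset]
      exact ⟨fun h => hne (by rw [h]), hx⟩
    · refine Finset.mem_union_right _ (Finset.mem_image.2 ⟨x, ?_, rfl⟩)
      simp only [Finset.mem_erase, SimpleGraph.mem_neighborFinset]
      exact ⟨fun h => hne (by rw [h, Sym2.eq_swap]), hx⟩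
  refine ⟨S.filter fun s => s % K ∉ A.image fun e => c e % K, Finset.filter_subset _ _, ?_, ?_⟩
  · have h1 := Finset.card_filter_add_card_filter_not (s := S)
      (fun s => s % K ∈ A.image fun e => c e % K)
    have h2 : (S.filter fun s => s % K ∈ A.image fun e => c e % K).card
        ≤ (A.image fun e => c e % K).card := by
      refine Finset.card_le_card_of_injOn (· % K) (fun s hs => (Finset.mem_filter.1 hs).2) ?_
      intro a ha b hb
      have ha := hS (Finset.mem_filter.1 ha).1
      have hb := hS (Finset.mem_filter.1 hb).1
      exact injOn_emod K (by simpa using ha) (by simpa using hb)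
    have h3 := Finset.card_image_le (s := A) (f := fun e => c e % K)
    omega
  · intro s hs
    have hs := (Finset.mem_filter.1 hs).2
    have key : ∀ e ∈ F, e ≠ s(w, y) → (∃ v, v ∈ e ∧ v ∈ s(w, y)) → c e % K ≠ s % K :=
      fun e he hne hv h => hs (Finset.mem_image.2 ⟨e, hmemA e he hne hv, h⟩)
    intro e₁ h₁ e₂ h₂ hne hv
    by_cases he₁ : e₁ = s(w, y)
    · subst he₁
      rw [Function.update_self, Function.update_of_ne hne.symm]
      exact (key e₂ (h₂.resolve_left hne.symm) hne.symm (hv.imp fun _ h => h.symm)).symm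
    · rw [Function.update_of_ne he₁]
      by_cases he₂ : e₂ = s(w, y)
      · subst he₂
        rw [Function.update_self]
        exact key e₁ (h₁.resolve_left hne) hne hv
      · rw [Function.update_of_ne he₂]
        exact hc e₁ (h₁.resolve_left he₁) e₂ (h₂.resolve_left he₂) hne hv

theorem exists_low_colouring {K : ℤ} (hK : 2 * G.maxDegree - 1 ≤ K) :
    ∃ c : Sym2 V → ℤ, ProperOn K G.edgeSet c ∧
      ∀ e ∈ G.edgeSet, K + 1 ≤ c e ∧ c e ≤ K + 2 * G.maxDegree - 1 := by
  suffices h : ∀ F : Finset (Sym2 V), (F : Set (Sym2 V)) ⊆ G.edgeSet → ∃ c : Sym2 V → ℤ,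
      ProperOn K F c ∧ ∀ e ∈ F, K + 1 ≤ c e ∧ c e ≤ K + 2 * G.maxDegree - 1 by
    simpa using h G.edgeFinset (by simp)
  intro F
  induction F using Finset.induction_on with
  | empty => exact fun _ => ⟨fun _ => 0, fun e he => by simp at he, by simp⟩
  | insert e F he ih =>
    intro hF
    rw [Finset.coe_insert, Set.insert_subset_iff] at hF
    obtain ⟨c, hc, hlow⟩ := ih hF.2
    induction e with
    | h w y =>
    have hwy : G.Adj w y := hF.1
    have hpos : 1 ≤ G.maxDegree :=
      ((G.degree_pos_iff_exists_adj w).2 ⟨y, hwy⟩).trans_le (G.degree_le_maxDegree w)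
    obtain ⟨S', hS', hcard, hS⟩ := exists_free_colours hF.2 hc hwy
      (S := Finset.Icc (K + 1) (K + 2 * G.maxDegree - 1))
      (Finset.Icc_subset_Icc_right (by linarith))
    rw [Int.card_Icc] at hcard
    obtain ⟨s, hs⟩ : S'.Nonempty := Finset.card_pos.1 (by omega)
    refine ⟨Function.update c s(w, y) s, by simpa using hS s hs, fun e he' => ?_⟩
    by_cases h : e = s(w, y)
    · subst h
      simpa using hS' hs
    · rw [Function.update_of_ne h]
      exact hlow e ((Finset.mem_insert.1 he').resolve_left h)
theorem geom_sum_add_le {Δ r : ℕ} (hΔ : 2 ≤ Δ) (hr : 4 ≤ r) :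
    ∑ i ∈ Finset.range r, (Δ - 1) ^ i + 2 * Δ * (Δ - 1) ≤ Δ ^ (r - 1) := by
  obtain ⟨d, rfl⟩ : ∃ d, Δ = d + 1 := ⟨Δ - 1, by omega⟩
  rw [Nat.add_sub_cancel]
  induction r, hr using Nat.le_induction with
  | base => simp [Finset.sum_range_succ]; ring_nf; omega
  | succ n hn ih =>
    obtain ⟨m, rfl⟩ : ∃ m, n = m + 1 := ⟨n - 1, by omega⟩
    rw [Finset.sum_range_succ']
    simp only [Nat.add_sub_cancel, pow_succ, ← Finset.sum_mul] at ih ⊢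
    have : 1 ≤ ∑ i ∈ Finset.range (m + 1), d ^ i := by
      rw [Finset.sum_range_succ']; simp
    rw [pow_zero]
    have h1 := Nat.mul_le_mul_right (d + 1) ih
    have h2 := Nat.zero_le (2 * (d + 1) * d * d)
    linarith

theorem exists_adj_dist_eq {V : Type*} (G : SimpleGraph V) {w y : V} {n : ℕ}
    (h : G.dist w y = n + 1) : ∃ x, G.Adj x y ∧ G.dist w x = n := by
  have hreach : G.Reachable y w := by
    by_contra hr
    rw [SimpleGraph.dist_comm, SimpleGraph.dist_eq_zero_of_not_reachable hr] at h
    omega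
  obtain ⟨p, hp⟩ := hreach.exists_walk_length_eq_dist
  have h1 := G.dist_comm (u := w) (v := y)
  cases p with
  | nil => simp at h
  | @cons _ x _ hadj q =>
    obtain ⟨q', hq'⟩ := q.reachable.exists_walk_length_eq_dist
    have h2 := G.dist_comm (u := w) (v := x)
    have h3 := SimpleGraph.dist_le q
    have h4 := SimpleGraph.dist_le (q'.cons hadj)
    rw [SimpleGraph.Walk.length_cons] at hp h4
    exact ⟨x, hadj.symm, by omega⟩


theorem card_sphere_succ_le (G : SimpleGraph V) [DecidableRel G.Adj] (w : V) {k : ℕ} :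
    (Finset.univ.filter fun y => G.dist w y = k + 1).card ≤
      G.degree w * (G.maxDegree - 1) ^ k := by
  induction k with
  | zero =>
    simp only [zero_add, pow_zero, mul_one, SimpleGraph.dist_eq_one_iff_adj]
    rw [← G.card_neighborFinset_eq_degree]
    exact Finset.card_le_card fun y hy => by simpa using hy
  | succ k ih =>
    have hsub : (Finset.univ.filter fun y => G.dist w y = k + 1 + 1) ⊆
        (Finset.univ.filter fun y => G.dist w y = k + 1).biUnion
          fun x => (G.neighborFinset x).filter fun y => G.dist w y = k + 1 + 1 := by
      intro y hy
      have hy : G.dist w y = k + 1 + 1 := by simpa using hy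
      obtain ⟨x, hx⟩ := exists_adj_dist_eq G hy
      simpa [hy] using ⟨x, hx.2, hx.1⟩
    refine (Finset.card_le_card hsub).trans ((Finset.card_biUnion_le_card_mul _ _
      (G.maxDegree - 1) fun x hx => ?_).trans ?_)
    · have hx : G.dist w x = k + 1 := by simpa using hx
      obtain ⟨z, hz⟩ := exists_adj_dist_eq G hx
      have : ((G.neighborFinset x).filter fun y => G.dist w y = k + 1 + 1) ⊆
          (G.neighborFinset x).erase z := by
        intro y hy
        rw [Finset.mem_filter] at hy
        refine Finset.mem_erase.2 ⟨?_, hy.1⟩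
        rintro rfl
        omega
      refine (Finset.card_le_card this).trans ?_
      rw [Finset.card_erase_of_mem (by simpa using hz.1.symm), G.card_neighborFinset_eq_degree]
      exact Nat.sub_le_sub_right (G.degree_le_maxDegree x) 1
    · rw [pow_succ, ← mul_assoc]
      exact Nat.mul_le_mul_right _ ih

theorem card_ball_le (G : SimpleGraph V) [DecidableRel G.Adj] (w : V) (r : ℕ) :
    (Finset.univ.filter fun y => 0 < G.dist w y ∧ G.dist w y ≤ r).card ≤
      G.degree w * ∑ i ∈ Finset.range r, (G.maxDegree - 1) ^ i := by
  have : (Finset.univ.filter fun y => 0 < G.dist w y ∧ G.dist w y ≤ r) ⊆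
      (Finset.range r).biUnion fun i => Finset.univ.filter fun y => G.dist w y = i + 1 := by
    intro y hy
    have hy : 0 < G.dist w y ∧ G.dist w y ≤ r := by simpa using hy
    simp only [Finset.mem_biUnion, Finset.mem_range, Finset.mem_filter, Finset.mem_univ, true_and]
    exact ⟨G.dist w y - 1, by omega, by omega⟩
  refine (Finset.card_le_card this).trans (Finset.card_biUnion_le.trans ?_)
  rw [Finset.mul_sum]
  exact Finset.sum_le_sum fun i _ => card_sphere_succ_le G w

theorem exists_many_sums {K : ℤ} (hK : 0 < K) {c : Sym2 V → ℤ} (hc : ProperOn K G.edgeSet c)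
    {w z : V} (hz : G.Adj w z) (b : ℕ) {F : Finset V} (hF : F ⊆ G.neighborFinset w)
    (hzF : z ∉ F) (hlow : ∀ y ∈ F, K + 1 ≤ c s(w, y) ∧ c s(w, y) ≤ K + 2 * G.maxDegree - 1)
    (hL : 4 * G.maxDegree - 3 ≤ K) :
    ∃ X : Finset ℤ,
      ((b + 1 + F.card : ℕ) : ℤ) * (K - 4 * G.maxDegree + 3) ≤ X.card ∧
      ∀ t ∈ X, ∃ i ≤ b, ∃ c' : Sym2 V → ℤ, (∀ e, w ∉ e → c' e = c e) ∧
        (∀ y, y ∉ F → y ≠ z → c' s(w, y) = c s(w, y)) ∧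
        (∀ y ∈ insert z F, K + 1 ≤ c' s(w, y) ∧ c' s(w, y) ≤ 2 * K) ∧
        ProperOn K G.edgeSet c' ∧ t = vertexSum G c' w + K * (i : ℕ) := by
  have hpos : 1 ≤ G.maxDegree :=
    ((G.degree_pos_iff_exists_adj w).2 ⟨z, hz⟩).trans_le (G.degree_le_maxDegree w)
  induction F using Finset.induction_on with
  | empty =>
    obtain ⟨S, hS, hcard, hprop⟩ := exists_free_colours subset_rfl hc hz
      (S := Finset.Icc (K + 1) (2 * K)) subset_rfl
    rw [Set.insert_eq_of_mem (by simpa using hz)] at hprop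
    rw [Int.card_Icc] at hcard
    refine ⟨(Finset.range (b + 1) ×ˢ S).image fun p =>
      vertexSum G c w - c s(w, z) + p.2 + K * p.1, ?_, ?_⟩
    · rw [Finset.card_image_of_injOn, Finset.card_product, Finset.card_range]
      · have : K - 4 * G.maxDegree + 3 ≤ S.card := by omega
        push_cast
        simp only [Finset.card_empty, Nat.cast_zero, add_zero]
        exact mul_le_mul_of_nonneg_left this (by positivity)
      · rintro ⟨i, x⟩ hp ⟨j, y⟩ hq h
        simp only [Finset.coe_product, Set.mem_prod, Finset.mem_coe] at hp hq
        have hx := Finset.mem_Icc.1 (hS hp.2)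
        have hy := Finset.mem_Icc.1 (hS hq.2)
        simp only at h hx hy
        have hxy : x = y := injOn_emod K hx hy (by
          have : x = y + K * (j - i) := by linear_combination h
          simp [this])
        subst hxy
        have : K * (i : ℤ) = K * j := by linarith
        simpa using mul_left_cancel₀ hK.ne' this
    · intro t ht
      obtain ⟨⟨i, x⟩, hp, rfl⟩ := Finset.mem_image.1 ht
      rw [Finset.mem_product, Finset.mem_range] at hp
      refine ⟨i, by have := hp.1; simp only at this; omega, Function.update c s(w, z) x,
        fun e he => Function.update_of_ne (by rintro rfl; simp at he) _ _,
        fun y _ hy => Function.update_of_ne (fun h => hy (Sym2.congr_right.1 h)) _ _,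
        fun y hy => ?_, hprop x hp.2, ?_⟩
      · obtain rfl : y = z := by simpa using hy
        simpa using hS hp.2
      · rw [vertexSum_update hz]
  | insert y F hy ih =>
    rw [Finset.insert_subset_iff] at hF
    have hwy : G.Adj w y := by simpa using hF.1
    have hyz : y ≠ z := by rintro rfl; simp at hzF
    obtain ⟨X, hX, hX'⟩ := ih hF.2 (fun h => hzF (Finset.mem_insert_of_mem h))
      fun y hy => hlow y (Finset.mem_insert_of_mem hy)
    have hylow := hlow y (Finset.mem_insert_self y F)
    rcases hL.eq_or_lt with hL | hL
    · refine ⟨∅, by simp [← hL], by simp⟩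
    have hne : X.Nonempty := by
      rw [← Finset.card_pos]
      have : 0 < ((b + 1 + F.card : ℕ) : ℤ) * (K - 4 * G.maxDegree + 3) :=
        mul_pos (by positivity) (by linarith)
      omega
    obtain ⟨i, hi, c', h1, h2, h3, h4, h5⟩ := hX' _ (X.max'_mem hne)
    have hcy := h2 y hy hyz
    obtain ⟨S, hS, hcard, hprop⟩ := exists_free_colours subset_rfl h4 hwy
      (S := Finset.Icc (c s(w, y) + 1) (2 * K)) (Finset.Icc_subset_Icc_left (by linarith))
    rw [Set.insert_eq_of_mem (by simpa using hwy)] at hprop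
    rw [Int.card_Icc] at hcard
    refine ⟨X ∪ S.image fun s => X.max' hne - c s(w, y) + s, ?_, ?_⟩
    · rw [Finset.card_union_of_disjoint, Finset.card_image_of_injective _ (add_right_injective _),
        Finset.card_insert_of_notMem hy]
      · have : K - 4 * G.maxDegree + 3 ≤ S.card := by omega
        push_cast at hX ⊢
        linarith
      · rw [Finset.disjoint_right]
        intro t ht hmem
        obtain ⟨s, hs, rfl⟩ := Finset.mem_image.1 ht
        have h6 := X.le_max' _ hmem
        have h7 := Finset.mem_Icc.1 (hS hs)
        linarith
    · intro t ht
      rcases Finset.mem_union.1 ht with ht | ht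
      · obtain ⟨i, hi, c', h1, h2, h3, h4, h5⟩ := hX' t ht
        refine ⟨i, hi, c', h1, fun x hx => h2 x fun h => hx (Finset.mem_insert_of_mem h),
          fun x hx => ?_, h4, h5⟩
        by_cases hxy : x = y
        · subst hxy
          rw [h2 x hy hyz]
          exact ⟨hylow.1, by linarith⟩
        · exact h3 x (by simp only [Finset.mem_insert] at hx ⊢; tauto)
      · obtain ⟨s, hs, rfl⟩ := Finset.mem_image.1 ht
        have hs' := Finset.mem_Icc.1 (hS hs)
        refine ⟨i, hi, Function.update c' s(w, y) s, fun e he => ?_, fun x hx hxz => ?_,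
          fun x hx => ?_, hprop s hs, ?_⟩
        · rw [Function.update_of_ne (by rintro rfl; simp at he), h1 e he]
        · have hxy : x ≠ y := by rintro rfl; simp at hx
          rw [Function.update_of_ne (fun h => hxy (Sym2.congr_right.1 h)),
            h2 x (fun h => hx (Finset.mem_insert_of_mem h)) hxz]
        · by_cases hxy : x = y
          · subst hxy
            rw [Function.update_self]
            exact ⟨by linarith, hs'.2⟩
          · rw [Function.update_of_ne (fun h => hxy (Sym2.congr_right.1 h))]
            exact h3 x (by simp only [Finset.mem_insert] at hx ⊢; tauto)
        · rw [vertexSum_update hwy, hcy, h5]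
          ring

/-- The vertices of `P` are pairwise distinguished up to shifts by `K` within pairs, and the edges
not yet used keep the freedom needed to process the remaining vertices. -/
structure PartialColouring (G : SimpleGraph V) [DecidableRel G.Adj] (K : ℤ) (r : ℕ)
    (P : Finset V) (c : Sym2 V → ℤ) : Prop where
  range : ∀ e ∈ G.edgeSet, 1 ≤ c e ∧ c e ≤ 3 * K
  middle : ∀ x y, G.Adj x y → x ∉ P → K + 1 ≤ c s(x, y) ∧ c s(x, y) ≤ 2 * K
  low : ∀ x y, G.Adj x y → x ∉ P → y ∉ P → c s(x, y) ≤ K + 2 * G.maxDegree - 1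
  proper : ProperOn K G.edgeSet c
  distinct : ∀ x ∈ P, ∀ y ∈ P, 0 < G.dist x y → G.dist x y ≤ r →
    pairMin K (vertexSum G c x) ≠ pairMin K (vertexSum G c y)

theorem PartialColouring.exists_insert {K : ℤ} (hK : 0 < K) {r : ℕ} {P : Finset V}
    {c : Sym2 V → ℤ} (h : PartialColouring G K r P c) {w z : V} (hw : w ∉ P) (hz : z ∉ P)
    (hwz : G.Adj w z)
    (hL : 2 * ∑ i ∈ Finset.range r, ((G.maxDegree - 1 : ℕ) : ℤ) ^ i < K - 4 * G.maxDegree + 3)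
    (hball : (Finset.univ.filter fun y => 0 < G.dist w y ∧ G.dist w y ≤ r).card ≤
      G.degree w * ∑ i ∈ Finset.range r, (G.maxDegree - 1) ^ i) :
    ∃ c', PartialColouring G K r (insert w P) c' := by
  have hsum : 0 ≤ ∑ i ∈ Finset.range r, ((G.maxDegree - 1 : ℕ) : ℤ) ^ i := by positivity
  set Q := (G.neighborFinset w).filter (· ∈ P) with hQ
  set F := ((G.neighborFinset w).filter (· ∉ P)).erase z with hF
  have hcard : Q.card + 1 + F.card = G.degree w := by
    rw [← G.card_neighborFinset_eq_degree, hF, Finset.card_erase_of_mem (by simp [hwz, hz]), hQ,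
      ← Finset.card_filter_add_card_filter_not (s := G.neighborFinset w) (· ∈ P)]
    have : 0 < ((G.neighborFinset w).filter (· ∉ P)).card :=
      Finset.card_pos.2 ⟨z, by simp [hwz, hz]⟩
    omega
  have hmemF : ∀ y, y ∈ F ↔ y ≠ z ∧ G.Adj w y ∧ y ∉ P := by simp [hF]
  have hmemQ : ∀ y, y ∈ Q ↔ G.Adj w y ∧ y ∈ P := by simp [hQ]
  obtain ⟨X, hX, hX'⟩ := exists_many_sums hK h.proper hwz Q.card (F := F)
    (fun y hy => by simpa using ((hmemF y).1 hy).2.1) (by simp [hF])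
    (fun y hy => by
      obtain ⟨_, h2, h3⟩ := (hmemF y).1 hy
      exact ⟨(h.middle w y h2 hw).1, h.low w y h2 hw h3⟩) (by linarith)
  rw [hcard] at hX
  set H : ℤ := ∑ y ∈ Q, level K (vertexSum G c y) with hH
  obtain ⟨t, ht, htP⟩ : ∃ t ∈ X, ∀ y ∈ P, 0 < G.dist w y → G.dist w y ≤ r →
      pairMin K (t - K * H) ≠ pairMin K (vertexSum G c y) := by
    by_contra! hcon
    have hsub : X ⊆ (Finset.univ.filter fun y => 0 < G.dist w y ∧ G.dist w y ≤ r).biUnion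
        fun y => {pairMin K (vertexSum G c y) + K * H, pairMin K (vertexSum G c y) + K + K * H} := by
      intro t ht
      obtain ⟨y, -, h1, h2, h3⟩ := hcon t ht
      refine Finset.mem_biUnion.2 ⟨y, by simp [h1, h2], ?_⟩
      rw [Finset.mem_insert, Finset.mem_singleton, ← h3]
      rcases eq_pairMin_or K (t - K * H) with h | h
      · left; linarith
      · right; linarith
    have h1 := (Finset.card_le_card hsub).trans
      (Finset.card_biUnion_le_card_mul _ _ 2 fun y _ => Finset.card_le_two)
    have hdeg : 0 < (G.degree w : ℤ) := by omega
    zify at h1 hball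
    nlinarith
  obtain ⟨i, hi, c₁, h1, h2, h3, h4, rfl⟩ := hX' t ht
  have hsum₁ : ∀ y ∈ P, vertexSum G c₁ y = vertexSum G c y := fun y hy => by
    have hyw : y ≠ w := by rintro rfl; exact hw hy
    by_cases hwy : G.Adj w y
    · rw [vertexSum_of_adj h1 hwy, h2 y (fun h => ((hmemF y).1 h).2.2 hy)
        (by rintro rfl; exact hz hy)]
      ring
    · exact vertexSum_of_not_adj h1 hyw hwy
  have hQadj : ∀ y ∈ Q, G.Adj w y := fun y hy => ((hmemQ y).1 hy).1
  have hQP : ∀ y ∈ Q, y ∈ P := fun y hy => ((hmemQ y).1 hy).2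
  have hcQ : ∀ y ∈ Q, c₁ s(w, y) = c s(w, y) := fun y hy =>
    h2 y (fun h => ((hmemF y).1 h).2.2 (hQP y hy)) (by rintro rfl; exact hz (hQP y hy))
  obtain ⟨T, hT, rfl⟩ := Finset.exists_subset_card_eq hi
  obtain ⟨c₂, k1, k2, k3, k4, k5⟩ := exists_set_levels hK c₁ (w := w) (Q := Q) (T := T)
    (Finset.filter_subset _ _) hT
  have hH₁ : ∑ y ∈ Q, level K (vertexSum G c₁ y) = H :=
    Finset.sum_congr rfl fun y hy => by rw [hsum₁ y (hQP y hy)]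
  rw [hH₁] at k5
  have hpm : ∀ y ∈ P, pairMin K (vertexSum G c₂ y) = pairMin K (vertexSum G c y) := fun y hy => by
    rw [← hsum₁ y hy]
    by_cases hyQ : y ∈ Q
    · exact k3 y hyQ
    · rw [k4 y (by rintro rfl; exact hw hy) hyQ]
  have hwP : pairMin K (vertexSum G c₂ w) = pairMin K (vertexSum G c₁ w + K * T.card - K * H) := by
    rw [k5]; congr 1; ring
  have hoff : ∀ x y, x ≠ w → y ≠ w → c₂ s(x, y) = c s(x, y) := fun x y hx hy => by
    have : w ∉ s(x, y) := by simp [hx.symm, hy.symm]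
    rw [k1 _ (by rintro u - h; simp [h] at this), h1 _ this]
  have hmid : ∀ y, G.Adj w y → y ∉ P → K + 1 ≤ c₂ s(w, y) ∧ c₂ s(w, y) ≤ 2 * K :=
    fun y hy hyP => by
      rw [k1 _ fun u hu he => hyP (by rw [Sym2.congr_right.1 he]; exact hQP u hu)]
      refine h3 y ?_
      by_cases hyz : y = z
      · simp [hyz]
      · exact Finset.mem_insert_of_mem ((hmemF y).2 ⟨hyz, hy, hyP⟩)
  have hrange : ∀ y, G.Adj w y → 1 ≤ c₂ s(w, y) ∧ c₂ s(w, y) ≤ 3 * K := fun y hy => by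
    by_cases hyP : y ∈ P
    · have hyQ := (hmemQ y).2 ⟨hy, hyP⟩
      obtain ⟨τ, hτ1, hτ2, hτ⟩ := k2 y hyQ
      have := h.middle w y hy hw
      rw [hτ, hcQ y hyQ]
      constructor <;> nlinarith
    · have := hmid y hy hyP
      constructor <;> linarith
  refine ⟨c₂, ⟨fun e he => ?_, fun x y hxy hx => ?_, fun x y hxy hx hy => ?_, h4.congr fun e => ?_,
    fun x hx y hy hd hr => ?_⟩⟩
  · induction e with
    | h x y =>
    have hxy : G.Adj x y := he
    by_cases hxw : x = w
    · subst hxw; exact hrange y hxy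
    by_cases hyw : y = w
    · subst hyw; rw [Sym2.eq_swap]; exact hrange x hxy.symm
    rw [hoff x y hxw hyw]
    exact h.range _ he
  · rw [Finset.mem_insert, not_or] at hx
    by_cases hyw : y = w
    · subst hyw; rw [Sym2.eq_swap]; exact hmid x hxy.symm hx.2
    rw [hoff x y hx.1 hyw]
    exact h.middle x y hxy hx.2
  · rw [Finset.mem_insert, not_or] at hx hy
    rw [hoff x y hx.1 hy.1]
    exact h.low x y hxy hx.2 hy.2
  · by_cases he : ∃ y ∈ Q, e = s(w, y)
    · obtain ⟨y, hy, rfl⟩ := he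
      obtain ⟨τ, -, -, hτ⟩ := k2 y hy
      simp [hτ]
    · push Not at he
      rw [k1 e he]
  · rw [Finset.mem_insert] at hx hy
    rcases hx with rfl | hx <;> rcases hy with rfl | hy
    · simp at hd
    · rw [hwP, hpm y hy]
      exact htP y hy hd hr
    · rw [hwP, hpm x hx]
      rw [SimpleGraph.dist_comm] at hd hr
      exact (htP x hx hd hr).symm
    · rw [hpm x hx, hpm y hy]
      exact h.distinct x hx y hy hd hr

theorem exists_subset_avoiding {K : ℤ} (hK : 0 < K) (Q : Finset V) (s H : ℤ) {B : Finset ℤ}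
    (hB : (B.filter fun t => t % K = s % K).card ≤ Q.card) :
    ∃ T ⊆ Q, s + K * (T.card - H) ∉ B := by
  by_contra! hcon
  have hmaps : ∀ i ∈ Finset.range (Q.card + 1),
      s + K * ((i : ℤ) - H) ∈ B.filter fun t => t % K = s % K := by
    intro i hi
    obtain ⟨T, hT, rfl⟩ := Finset.exists_subset_card_eq (Nat.lt_succ_iff.1 (Finset.mem_range.1 hi))
    exact Finset.mem_filter.2 ⟨hcon T hT, by simp⟩
  have := Finset.card_le_card_of_injOn _ hmaps (by
    intro i _ j _ h
    have h : K * (i : ℤ) = K * j := by simp only at h; linarith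
    simpa using mul_left_cancel₀ hK.ne' h)
  rw [Finset.card_range] at this
  omega

theorem exists_finish_of_ordered {K : ℤ} (hK : 0 < K) {r : ℕ} {P : Finset V} {c : Sym2 V → ℤ}
    {u v : V} (huv : G.Adj u v) (hu : u ∉ P) (hv : v ∉ P)
    (hNu : ∀ y, G.Adj u y → y ≠ v → y ∈ P) (hNv : ∀ y, G.Adj v y → y ≠ u → y ∈ P)
    (hrange : ∀ e ∈ G.edgeSet, 1 ≤ c e ∧ c e ≤ 3 * K)
    (hmid : ∀ x y, G.Adj x y → x ∉ P → K + 1 ≤ c s(x, y) ∧ c s(x, y) ≤ 2 * K)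
    (hprop : ProperOn K G.edgeSet c)
    (hdist : ∀ x ∈ P, ∀ y ∈ P, 0 < G.dist x y → G.dist x y ≤ r →
      pairMin K (vertexSum G c x) ≠ pairMin K (vertexSum G c y))
    {B : V → Finset ℤ}
    (hB : ∀ w, ∀ y ∈ P, 0 < G.dist w y → G.dist w y ≤ r →
      vertexSum G c y ∈ B w ∧ ((G.Adj u y ∨ G.Adj v y) →
        pairMin K (vertexSum G c y) ∈ B w ∧ pairMin K (vertexSum G c y) + K ∈ B w))
    (hBu : ((B u).filter fun t => t % K = vertexSum G c u % K).card < G.degree u)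
    (hBv : ((B v).filter fun t => t % K = vertexSum G c v % K).card < G.degree v)
    (hcase : ((B v).filter fun t => t % K = vertexSum G c v % K).card + 1 < G.degree v ∨
      G.degree u = 1 ∧ 2 ≤ G.degree v) :
    ∃ c' : Sym2 V → ℤ, (∀ e ∈ G.edgeSet, 1 ≤ c' e ∧ c' e ≤ 3 * K) ∧ ProperOn K G.edgeSet c' ∧
      ∀ x ∈ insert u (insert v P), ∀ y ∈ insert u (insert v P), 0 < G.dist x y →
        G.dist x y ≤ r → vertexSum G c' x ≠ vertexSum G c' y := by
  have hne := huv.ne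
  set Qu := (G.neighborFinset u).erase v with hQu
  set Qv := (G.neighborFinset v).erase u with hQv
  have hmemQu : ∀ y, y ∈ Qu ↔ y ≠ v ∧ G.Adj u y := by simp [hQu]
  have hmemQv : ∀ y, y ∈ Qv ↔ y ≠ u ∧ G.Adj v y := by simp [hQv]
  have hQuP : ∀ y ∈ Qu, y ∈ P := fun y hy => hNu y ((hmemQu y).1 hy).2 ((hmemQu y).1 hy).1
  have hQvP : ∀ y ∈ Qv, y ∈ P := fun y hy => hNv y ((hmemQv y).1 hy).2 ((hmemQv y).1 hy).1
  have hcu : Qu.card + 1 = G.degree u := by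
    rw [← G.card_neighborFinset_eq_degree, hQu, Finset.card_erase_add_one (by simpa using huv)]
  have hcv : Qv.card + 1 = G.degree v := by
    rw [← G.card_neighborFinset_eq_degree, hQv, Finset.card_erase_add_one (by simpa using huv.symm)]
  obtain ⟨T, hT, hTB⟩ := exists_subset_avoiding hK Qu (vertexSum G c u)
    (∑ y ∈ Qu, level K (vertexSum G c y)) (B := B u) (by omega)
  obtain ⟨c₁, k1, k2, k3, k4, k5⟩ := exists_set_levels hK c (Finset.erase_subset _ _) hT
  rw [← k5] at hTB
  have hv₁ : vertexSum G c₁ v = vertexSum G c v := k4 v hne.symm fun h => hv (hQuP v h)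
  obtain ⟨B', hBB', hB'card, hB'u⟩ : ∃ B', B v ⊆ B' ∧
      (B'.filter fun t => t % K = vertexSum G c₁ v % K).card ≤ Qv.card ∧
      (vertexSum G c₁ u ∈ B' ∨ G.degree u = 1 ∧ 2 ≤ G.degree v) := by
    rcases hcase with h | h
    · refine ⟨insert (vertexSum G c₁ u) (B v), Finset.subset_insert _ _, ?_, by simp⟩
      rw [hv₁, Finset.filter_insert]
      split_ifs
      · exact (Finset.card_insert_le _ _).trans (by omega)
      · omega
    · exact ⟨B v, subset_rfl, by rw [hv₁]; omega, Or.inr h⟩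
  obtain ⟨T', hT', hTB'⟩ := exists_subset_avoiding hK Qv (vertexSum G c₁ v)
    (∑ y ∈ Qv, level K (vertexSum G c₁ y)) hB'card
  obtain ⟨c₂, l1, l2, l3, l4, l5⟩ := exists_set_levels hK c₁ (Finset.erase_subset _ _) hT'
  rw [← l5] at hTB'
  have hu₂ : vertexSum G c₂ u = vertexSum G c₁ u := l4 u hne fun h => hu (hQvP u h)
  have hcQv : ∀ y ∈ Qv, c₁ s(v, y) = c s(v, y) := fun y hy => k1 _ fun x hx he => by
    rcases Sym2.eq_iff.1 he with ⟨h, -⟩ | ⟨h, -⟩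
    · exact hne h.symm
    · exact hv (h ▸ hQuP x hx)
  have hrange₁ : ∀ e ∈ G.edgeSet, 1 ≤ c₁ e ∧ c₁ e ≤ 3 * K := fun e he => by
    by_cases h : ∃ y ∈ Qu, e = s(u, y)
    · obtain ⟨y, hy, rfl⟩ := h
      obtain ⟨τ, h1, h2, h3⟩ := k2 y hy
      have := hmid u y he hu
      rw [h3]
      constructor <;> nlinarith
    · push Not at h
      rw [k1 e h]
      exact hrange e he
  have hrange₂ : ∀ e ∈ G.edgeSet, 1 ≤ c₂ e ∧ c₂ e ≤ 3 * K := fun e he => by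
    by_cases h : ∃ y ∈ Qv, e = s(v, y)
    · obtain ⟨y, hy, rfl⟩ := h
      obtain ⟨τ, h1, h2, h3⟩ := l2 y hy
      have := hmid v y he hv
      rw [h3, hcQv y hy]
      constructor <;> nlinarith
    · push Not at h
      rw [l1 e h]
      exact hrange₁ e he
  have hprop₁ : ProperOn K G.edgeSet c₁ := hprop.congr fun e => by
    by_cases h : ∃ y ∈ Qu, e = s(u, y)
    · obtain ⟨y, hy, rfl⟩ := h
      obtain ⟨τ, -, -, h3⟩ := k2 y hy
      simp [h3]
    · push Not at h
      rw [k1 e h]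
  have hprop₂ : ProperOn K G.edgeSet c₂ := hprop₁.congr fun e => by
    by_cases h : ∃ y ∈ Qv, e = s(v, y)
    · obtain ⟨y, hy, rfl⟩ := h
      obtain ⟨τ, -, -, h3⟩ := l2 y hy
      simp [h3]
    · push Not at h
      rw [l1 e h]
  have hPu : ∀ y ∈ P, y ≠ u := fun y hy h => hu (h ▸ hy)
  have hPv : ∀ y ∈ P, y ≠ v := fun y hy h => hv (h ▸ hy)
  have hpm : ∀ y ∈ P, pairMin K (vertexSum G c₂ y) = pairMin K (vertexSum G c y) :=
    fun y hy => by
      have h1 : pairMin K (vertexSum G c₁ y) = pairMin K (vertexSum G c y) := by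
        by_cases h : y ∈ Qu
        · exact k3 y h
        · rw [k4 y (hPu y hy) h]
      by_cases h : y ∈ Qv
      · rw [l3 y h, h1]
      · rw [l4 y (hPv y hy) h, h1]
  have hmemB : ∀ w, ∀ y ∈ P, 0 < G.dist w y → G.dist w y ≤ r → vertexSum G c₂ y ∈ B w := by
    intro w y hy hd hr
    obtain ⟨h1, h2⟩ := hB w y hy hd hr
    by_cases hN : G.Adj u y ∨ G.Adj v y
    · obtain ⟨h3, h4⟩ := h2 hN
      rw [← hpm y hy] at h3 h4
      rcases eq_pairMin_or K (vertexSum G c₂ y) with h | h <;> rw [h] <;> assumption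
    · rw [not_or] at hN
      rwa [l4 y (hPv y hy) fun h => hN.2 ((hmemQv y).1 h).2,
        k4 y (hPu y hy) fun h => hN.1 ((hmemQu y).1 h).2]
  have huP : ∀ y ∈ P, 0 < G.dist u y → G.dist u y ≤ r →
      vertexSum G c₂ u ≠ vertexSum G c₂ y := fun y hy hd hr h =>
    hTB (by rw [← hu₂, h]; exact hmemB u y hy hd hr)
  have hvP : ∀ y ∈ P, 0 < G.dist v y → G.dist v y ≤ r →
      vertexSum G c₂ v ≠ vertexSum G c₂ y := fun y hy hd hr h =>
    hTB' (by rw [h]; exact hBB' (hmemB v y hy hd hr))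
  have huv₂ : vertexSum G c₂ u ≠ vertexSum G c₂ v := by
    rcases hB'u with h | ⟨h1, h2⟩
    · intro h'
      rw [← hu₂, h'] at h
      exact hTB' h
    · have hQu0 : Qu = ∅ := Finset.card_eq_zero.1 (by omega)
      have hsu : vertexSum G c₂ u = c₂ s(u, v) := by
        rw [vertexSum, ← Finset.add_sum_erase _ _ (by simpa using huv), ← hQu, hQu0]
        simp
      have hsv : vertexSum G c₂ v = c₂ s(u, v) + ∑ y ∈ Qv, c₂ s(v, y) := by
        rw [vertexSum, ← Finset.add_sum_erase _ _ (show u ∈ G.neighborFinset v by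
          simpa using huv.symm), ← hQv, Sym2.eq_swap]
      have hpos : 0 < ∑ y ∈ Qv, c₂ s(v, y) := by
        refine Finset.sum_pos (fun y hy => ?_) (Finset.card_pos.1 (by omega))
        have := (hrange₂ s(v, y) ((hmemQv y).1 hy).2).1
        linarith
      linarith
  refine ⟨c₂, hrange₂, hprop₂, fun x hx y hy hd hr => ?_⟩
  rw [Finset.mem_insert, Finset.mem_insert] at hx hy
  have hd' := hd
  have hr' := hr
  rw [SimpleGraph.dist_comm] at hd' hr'
  rcases hx with rfl | rfl | hx <;> rcases hy with rfl | rfl | hy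
  · simp at hd
  · exact huv₂
  · exact huP y hy hd hr
  · exact huv₂.symm
  · simp at hd
  · exact hvP y hy hd hr
  · exact (huP x hx hd' hr').symm
  · exact (hvP x hx hd' hr').symm
  · intro h
    refine hdist x hx y hy hd hr ?_
    rw [← hpm x hx, ← hpm y hy, h]

theorem sum_card_filter_emod_le {K : ℤ} {E : Finset ℤ} (hE : E ⊆ Finset.Icc (K + 1) (2 * K))
    (B : Finset ℤ) (a : ℤ) :
    ∑ x ∈ E, (B.filter fun t => t % K = (a + x) % K).card ≤ B.card := by
  rw [← Finset.card_biUnion]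
  · exact Finset.card_le_card (Finset.biUnion_subset.2 fun x _ => Finset.filter_subset _ _)
  · intro x hx y hy hxy
    rw [Function.onFun, Finset.disjoint_filter]
    intro t _ h1 h2
    refine hxy (injOn_emod K (by simpa using hE hx) (by simpa using hE hy) ?_)
    exact Int.ModEq.add_left_cancel' a (h1.symm.trans h2 : a + x ≡ a + y [ZMOD K])

/-- The sums to be avoided at `w` when the vertices of `N` may still move within their pairs. -/
noncomputable def forbiddenSums (G : SimpleGraph V) [DecidableRel G.Adj] (K : ℤ) (r : ℕ) (P N : Finset V)
    (c : Sym2 V → ℤ) (w : V) : Finset ℤ :=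
  ((P.filter fun y => 0 < G.dist w y ∧ G.dist w y ≤ r).image fun y => vertexSum G c y) ∪
    N.image fun y => if vertexSum G c y = pairMin K (vertexSum G c y)
      then pairMin K (vertexSum G c y) + K else pairMin K (vertexSum G c y)

theorem mem_forbiddenSums {K : ℤ} {r : ℕ} {P N : Finset V} {c : Sym2 V → ℤ} {w y : V}
    (hy : y ∈ P) (hd : 0 < G.dist w y) (hr : G.dist w y ≤ r) :
    vertexSum G c y ∈ forbiddenSums G K r P N c w ∧ (y ∈ N →
      pairMin K (vertexSum G c y) ∈ forbiddenSums G K r P N c w ∧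
      pairMin K (vertexSum G c y) + K ∈ forbiddenSums G K r P N c w) := by
  have h1 : vertexSum G c y ∈ forbiddenSums G K r P N c w :=
    Finset.mem_union_left _ (Finset.mem_image.2 ⟨y, by simp [hy, hd, hr], rfl⟩)
  refine ⟨h1, fun hN => ?_⟩
  have h2 := Finset.mem_union_right
    ((P.filter fun y => 0 < G.dist w y ∧ G.dist w y ≤ r).image fun y => vertexSum G c y)
    (Finset.mem_image_of_mem (fun y => if vertexSum G c y = pairMin K (vertexSum G c y)
      then pairMin K (vertexSum G c y) + K else pairMin K (vertexSum G c y)) hN)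
  change _ ∈ forbiddenSums G K r P N c w at h2
  by_cases h : vertexSum G c y = pairMin K (vertexSum G c y)
  · rw [if_pos h] at h2
    exact ⟨h ▸ h1, h2⟩
  · rw [if_neg h] at h2
    have h' := (eq_pairMin_or K (vertexSum G c y)).resolve_left h
    exact ⟨h2, h' ▸ h1⟩

theorem card_forbiddenSums_le (K : ℤ) (r : ℕ) (P N : Finset V) (c : Sym2 V → ℤ) (w : V) :
    (forbiddenSums G K r P N c w).card ≤
      G.degree w * ∑ i ∈ Finset.range r, (G.maxDegree - 1) ^ i + N.card := by
  refine (Finset.card_union_le _ _).trans (Nat.add_le_add (Finset.card_image_le.trans ?_)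
    Finset.card_image_le)
  exact (Finset.card_le_card (Finset.filter_subset_filter _ (Finset.subset_univ P))).trans
    (card_ball_le G w r)

theorem PartialColouring.exists_finish {K : ℤ} (hK : 0 < K) {r : ℕ} {P : Finset V}
    {c : Sym2 V → ℤ} (h : PartialColouring G K r P c) {u v : V} (huv : G.Adj u v) (hu : u ∉ P)
    (hv : v ∉ P) (hNu : ∀ y, G.Adj u y → y ≠ v → y ∈ P) (hNv : ∀ y, G.Adj v y → y ≠ u → y ∈ P)
    (hdeg : 2 ≤ G.degree u ∨ 2 ≤ G.degree v) (hΔ : 2 ≤ G.maxDegree)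
    (hKS : 2 * (∑ i ∈ Finset.range r, (G.maxDegree - 1) ^ i + 2 * G.maxDegree * (G.maxDegree - 1)
      : ℕ) ≤ K) :
    ∃ c' : Sym2 V → ℤ, (∀ e ∈ G.edgeSet, 1 ≤ c' e ∧ c' e ≤ 3 * K) ∧ ProperOn K G.edgeSet c' ∧
      ∀ x ∈ insert u (insert v P), ∀ y ∈ insert u (insert v P), 0 < G.dist x y →
        G.dist x y ≤ r → vertexSum G c' x ≠ vertexSum G c' y := by
  have hPu : ∀ y ∈ P, y ≠ u := fun y hy h => hu (h ▸ hy)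
  have hPv : ∀ y ∈ P, y ≠ v := fun y hy h => hv (h ▸ hy)
  have hupos : 0 < G.degree u := (G.degree_pos_iff_exists_adj u).2 ⟨v, huv⟩
  have hvpos : 0 < G.degree v := (G.degree_pos_iff_exists_adj v).2 ⟨u, huv.symm⟩
  have huΔ := G.degree_le_maxDegree u
  have hvΔ := G.degree_le_maxDegree v
  set N := (G.neighborFinset u).erase v ∪ (G.neighborFinset v).erase u with hN
  have hNcard : N.card + 2 ≤ G.degree u + G.degree v := by
    have h1 := Finset.card_union_le ((G.neighborFinset u).erase v) ((G.neighborFinset v).erase u)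
    rw [Finset.card_erase_of_mem (by simpa using huv), G.card_neighborFinset_eq_degree,
      Finset.card_erase_of_mem (by simpa using huv.symm), G.card_neighborFinset_eq_degree, ← hN] at h1
    omega
  have hmemN : ∀ y ∈ P, G.Adj u y ∨ G.Adj v y → y ∈ N := fun y hy hadj => by
    simp only [hN, Finset.mem_union, Finset.mem_erase, SimpleGraph.mem_neighborFinset]
    exact hadj.imp (fun h => ⟨hPv y hy, h⟩) fun h => ⟨hPu y hy, h⟩
  obtain ⟨E, hE, hEcard, hEprop⟩ := exists_free_colours subset_rfl h.proper huv
    (S := Finset.Icc (K + 1) (2 * K)) subset_rfl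
  rw [Set.insert_eq_of_mem (by simpa using huv)] at hEprop
  rw [Int.card_Icc] at hEcard
  set B : V → Finset ℤ := forbiddenSums G K r P N c with hBdef
  set β : V → ℤ → ℕ := fun w x =>
    ((B w).filter fun t => t % K = (vertexSum G c w - c s(u, v) + x) % K).card with hβ
  have hβsum : ∀ w, ∑ x ∈ E, β w x ≤
      G.degree w * ∑ i ∈ Finset.range r, (G.maxDegree - 1) ^ i + N.card := fun w =>
    (sum_card_filter_emod_le hE _ _).trans (card_forbiddenSums_le K r P N c w)
  obtain ⟨x, hx, hxβ⟩ : ∃ x ∈ E, β u x * G.degree v + β v x * G.degree u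
      < G.degree u * G.degree v := by
    by_contra! hcon
    have h1 := Finset.card_nsmul_le_sum E _ _ hcon
    rw [Finset.sum_add_distrib, ← Finset.sum_mul, ← Finset.sum_mul, smul_eq_mul] at h1
    have h2 := Nat.mul_le_mul_right (G.degree v) (hβsum u)
    have h3 := Nat.mul_le_mul_right (G.degree u) (hβsum v)
    obtain ⟨d, hd⟩ : ∃ d, G.maxDegree = d + 1 := ⟨G.maxDegree - 1, by omega⟩
    rw [hd] at hKS hEcard h2 h3 huΔ hvΔ hΔ
    rw [Nat.add_sub_cancel] at hKS hEcard h2 h3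
    generalize ∑ i ∈ Finset.range r, d ^ i = S at *
    have h4 : 2 * S + 4 * (d + 1) * d ≤ E.card + 2 * d := by
      have : (2 * S + 4 * (d + 1) * d : ℤ) ≤ K := by push_cast at hKS; linarith
      zify; zify at hEcard; omega
    generalize G.degree u = a at *
    generalize G.degree v = b at *
    generalize E.card = m at *
    generalize N.card = n at *
    have h5 : m * (a * b) ≤ 2 * S * (a * b) + n * (a + b) := by nlinarith
    have h6 : n ≤ 2 * d := by omega
    have h7 : a + b ≤ 2 * (a * b) := by nlinarith
    have h8 : n * (a + b) ≤ 2 * d * (2 * (a * b)) := Nat.mul_le_mul h6 h7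
    have h9 : 0 < a * b := Nat.mul_pos hupos hvpos
    have h10 : m ≤ 2 * S + 4 * d :=
      Nat.le_of_mul_le_mul_right (by linarith) h9
    nlinarith
  set c₁ := Function.update c s(u, v) x with hc₁
  have hsu : vertexSum G c₁ u = vertexSum G c u - c s(u, v) + x := vertexSum_update huv x
  have hsv : vertexSum G c₁ v = vertexSum G c v - c s(u, v) + x := by
    rw [hc₁, Sym2.eq_swap]; exact vertexSum_update huv.symm x
  have hsP : ∀ y ∈ P, vertexSum G c₁ y = vertexSum G c y := fun y hy =>
    vertexSum_update_of_ne (hPu y hy) (hPv y hy) x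
  have hxK := Finset.mem_Icc.1 (hE hx)
  have hrange : ∀ e ∈ G.edgeSet, 1 ≤ c₁ e ∧ c₁ e ≤ 3 * K := fun e he => by
    by_cases heq : e = s(u, v)
    · rw [heq, hc₁, Function.update_self]; constructor <;> linarith
    · rw [hc₁, Function.update_of_ne heq]; exact h.range e he
  have hmid : ∀ y z, G.Adj y z → y ∉ P → K + 1 ≤ c₁ s(y, z) ∧ c₁ s(y, z) ≤ 2 * K :=
    fun y z hyz hy => by
      by_cases heq : s(y, z) = s(u, v)
      · rw [heq, hc₁, Function.update_self]; exact hxK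
      · rw [hc₁, Function.update_of_ne heq]; exact h.middle y z hyz hy
  have hdist : ∀ y ∈ P, ∀ z ∈ P, 0 < G.dist y z → G.dist y z ≤ r →
      pairMin K (vertexSum G c₁ y) ≠ pairMin K (vertexSum G c₁ z) := fun y hy z hz => by
    rw [hsP y hy, hsP z hz]; exact h.distinct y hy z hz
  have hB : ∀ w, ∀ y ∈ P, 0 < G.dist w y → G.dist w y ≤ r →
      vertexSum G c₁ y ∈ B w ∧ ((G.Adj u y ∨ G.Adj v y) →
        pairMin K (vertexSum G c₁ y) ∈ B w ∧ pairMin K (vertexSum G c₁ y) + K ∈ B w) :=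
    fun w y hy hd hr => by
      rw [hsP y hy]
      exact (mem_forbiddenSums hy hd hr).imp_right fun h hN => h (hmemN y hy hN)
  have hβu : β u x = ((B u).filter fun t => t % K = vertexSum G c₁ u % K).card := by rw [hsu]
  have hβv : β v x = ((B v).filter fun t => t % K = vertexSum G c₁ v % K).card := by rw [hsv]
  have hu' : β u x < G.degree u := by nlinarith
  have hv' : β v x < G.degree v := by nlinarith
  have hcases : (β v x + 1 < G.degree v ∨ G.degree u = 1 ∧ 2 ≤ G.degree v) ∨
      (β u x + 1 < G.degree u ∨ G.degree v = 1 ∧ 2 ≤ G.degree u) := by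
    by_contra! hcon
    obtain ⟨⟨h1, h2⟩, h3, h4⟩ := hcon
    have hu2 : 2 ≤ G.degree u := by omega
    have hv2 : 2 ≤ G.degree v := by omega
    have e1 : β u x + 1 = G.degree u := by omega
    have e2 : β v x + 1 = G.degree v := by omega
    rw [← e1, ← e2] at hxβ
    have f1 : 1 ≤ β u x := by omega
    have f2 : 1 ≤ β v x := by omega
    nlinarith
  rw [hβu] at hu'
  rw [hβv] at hv'
  rw [hβu, hβv] at hcases
  rcases hcases with hc | hc
  · exact exists_finish_of_ordered hK huv hu hv hNu hNv hrange hmid (hEprop x hx) hdist hB hu' hv' hc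
  · rw [Finset.insert_comm]
    exact exists_finish_of_ordered hK huv.symm hv hu hNv hNu hrange hmid (hEprop x hx) hdist
      (fun w y hy hd hr => (hB w y hy hd hr).imp_right fun h hN => h hN.symm) hv' hu' hc

theorem exists_colouring_of_component {r : ℕ} (hr : 4 ≤ r) (hΔ : 2 ≤ G.maxDegree)
    (hdeg : ∀ u v : V, G.Adj u v → 2 ≤ G.degree u ∨ 2 ≤ G.degree v) (v : V) :
    ∃ c : Sym2 V → ℤ, (∀ e ∈ G.edgeSet, 1 ≤ c e ∧ c e ≤ 6 * (G.maxDegree : ℤ) ^ (r - 1)) ∧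
      ProperOn (2 * (G.maxDegree : ℤ) ^ (r - 1)) G.edgeSet c ∧
      ∀ x y, G.Reachable v x → G.Reachable v y → 0 < G.dist x y →
        G.dist x y ≤ r → vertexSum G c x ≠ vertexSum G c y := by
  have hgeom := geom_sum_add_le hΔ hr
  obtain ⟨K, hKdef⟩ : ∃ K : ℤ, K = 2 * (G.maxDegree : ℤ) ^ (r - 1) := ⟨_, rfl⟩
  have hKS : 2 * (∑ i ∈ Finset.range r, (G.maxDegree - 1) ^ i
      + 2 * G.maxDegree * (G.maxDegree - 1) : ℕ) ≤ K := by
    rw [hKdef]; exact_mod_cast Nat.mul_le_mul_left 2 hgeom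
  have hL : 2 * ∑ i ∈ Finset.range r, ((G.maxDegree - 1 : ℕ) : ℤ) ^ i
      < K - 4 * G.maxDegree + 3 := by
    push_cast at hKS
    rw [Nat.cast_sub (by omega)] at hKS ⊢
    have : (2 : ℤ) ≤ G.maxDegree := by exact_mod_cast hΔ
    push_cast at hKS ⊢
    nlinarith
  have hS : 0 ≤ ∑ i ∈ Finset.range r, ((G.maxDegree - 1 : ℕ) : ℤ) ^ i := by positivity
  have hK : 0 < K := by rw [hKdef]; positivity
  rw [← hKdef, show 6 * (G.maxDegree : ℤ) ^ (r - 1) = 3 * K by rw [hKdef]; ring]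
  obtain ⟨c₀, hc₀, hlow⟩ := exists_low_colouring (G := G) (K := K) (by linarith)
  have hstart : PartialColouring G K r ∅ c₀ :=
    ⟨fun e he => by have := hlow e he; constructor <;> linarith,
      fun x y hxy _ => by have := hlow s(x, y) hxy; constructor <;> linarith,
      fun x y hxy _ _ => (hlow s(x, y) hxy).2, hc₀, by simp⟩
  by_cases hv : ∃ u, G.Adj v u
  swap
  · have hiso : ∀ x, G.Reachable v x → x = v := by
      rintro x ⟨p⟩
      cases p with
      | nil => rfl
      | cons hadj _ => exact absurd ⟨_, hadj⟩ hv
    refine ⟨c₀, hstart.range, hc₀, fun x y hx hy hd => ?_⟩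
    rw [hiso x hx, hiso y hy] at hd
    simp at hd
  obtain ⟨u, hvu⟩ := hv
  classical
  set P : Finset V := Finset.univ.filter fun y => G.Reachable v y ∧ y ≠ v ∧ y ≠ u with hP
  have hmemP : ∀ y, y ∈ P ↔ G.Reachable v y ∧ y ≠ v ∧ y ≠ u := by simp [hP]
  obtain ⟨c, hc⟩ : ∃ c, PartialColouring G K r P c := by
    suffices hind : ∀ s ⊆ P, ∃ c, PartialColouring G K r s c from hind P subset_rfl
    intro s
    induction s using Finset.induction_on_min_value (G.dist v) with
    | empty => exact fun _ => ⟨c₀, hstart⟩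
    | insert w s hw hmin ih =>
      intro hs
      rw [Finset.insert_subset_iff] at hs
      obtain ⟨c, hc⟩ := ih hs.2
      have hwP := (hmemP w).1 hs.1
      have hpos := hwP.1.pos_dist_of_ne hwP.2.1.symm
      obtain ⟨z, hzw, hz⟩ := exists_adj_dist_eq G (Nat.sub_add_cancel hpos).symm
      refine hc.exists_insert hK hw (fun hzs => ?_) hzw.symm hL (card_ball_le G w r)
      have := hmin z hzs
      omega
  obtain ⟨c', h1, h2, h3⟩ := hc.exists_finish hK hvu (by simp [hmemP]) (by simp [hmemP])
    (fun y hy hne => (hmemP y).2 ⟨hy.reachable, hy.ne', hne⟩)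
    (fun y hy hne => (hmemP y).2 ⟨hvu.reachable.trans hy.reachable, hne, hy.ne'⟩)
    (hdeg v u hvu) hΔ hKS
  have hmem : ∀ x, G.Reachable v x → x ∈ insert v (insert u P) := fun x hx => by
    simp only [Finset.mem_insert, hmemP]; tauto
  exact ⟨c', h1, h2, fun x y hx hy => h3 x (hmem x hx) y (hmem y hy)⟩

end DistSum

theorem distSumDistIndex_le_six_pow (V : Type) [Fintype V] [DecidableEq V]
    (G : SimpleGraph V) [DecidableRel G.Adj] (r : ℕ) (hr : 4 ≤ r)
    (hΔ : 2 ≤ G.maxDegree)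
    (hNoIsolatedEdge : ∀ u v : V, G.Adj u v → 2 ≤ G.degree u ∨ 2 ≤ G.degree v) :
    distSumDistIndex G r ≤ 6 * G.maxDegree ^ (r - 1) := by
  refine Nat.sInf_le ?_
  choose C hrange hproper hsum using DistSum.exists_colouring_of_component hr hΔ hNoIsolatedEdge
  set ρ : V → V := fun x => (G.connectedComponentMk x).out with hρ
  have hρr : ∀ x, G.Reachable (ρ x) x := fun x =>
    SimpleGraph.ConnectedComponent.exact (Quot.out_eq (G.connectedComponentMk x))
  have hρeq : ∀ x y, G.Reachable x y → ρ x = ρ y := fun x y h => by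
    simp only [hρ, SimpleGraph.ConnectedComponent.sound h]
  have hout : ∀ e ∈ G.edgeSet, ∀ x ∈ e, ρ e.out.1 = ρ x := fun e he x hx => by
    have h := e.out_fst_mem
    obtain ⟨y, rfl⟩ := hx
    rcases Sym2.mem_iff.1 h with h | h
    · rw [h]
    · rw [h]
      exact hρeq _ _ (SimpleGraph.Adj.reachable (SimpleGraph.mem_edgeSet G |>.1 he).symm)
  refine ⟨fun e => (C (ρ e.out.1) e).toNat, fun e he => ?_, fun e₁ h₁ e₂ h₂ hne hv heq => ?_,
    fun u v hd hle heq => ?_⟩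
  · have := hrange (ρ e.out.1) e he
    zify
    rw [Int.toNat_of_nonneg (by omega)]
    exact this
  · obtain ⟨x, hx₁, hx₂⟩ := hv
    simp only [hout e₁ h₁ x hx₁, hout e₂ h₂ x hx₂] at heq
    have := hrange (ρ x) e₁ h₁
    have := hrange (ρ x) e₂ h₂
    exact hproper (ρ x) e₁ h₁ e₂ h₂ hne ⟨x, hx₁, hx₂⟩ (by rw [show C (ρ x) e₁ = C (ρ x) e₂ by omega])
  · have key : ∀ x, ((∑ w ∈ G.neighborFinset x, (C (ρ s(x, w).out.1) s(x, w)).toNat : ℕ) : ℤ)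
        = DistSum.vertexSum G (C (ρ x)) x := fun x => by
      rw [Nat.cast_sum]
      refine Finset.sum_congr rfl fun w hw => ?_
      have hw : s(x, w) ∈ G.edgeSet := by simpa using hw
      rw [hout _ hw x (Sym2.mem_mk_left x w), Int.toNat_of_nonneg]
      linarith [hrange (ρ x) _ hw]
    have huv : G.Reachable u v := by
      by_contra h
      rw [SimpleGraph.dist_eq_zero_of_not_reachable h] at hd
      omega
    refine hsum (ρ u) u v (hρr u) ((hρr u).trans huv) hd hle ?_
    rw [← key u, hρeq u v huv, ← key v]
    exact_mod_cast heq
end
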